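/- Fix β > 0 and define f(x) = 1 − (1/β)·log(1 + e^β − e^{βx}) for x ∈ [0,1]. Let μ_β be the measure on [0,1]² given by μ_β = (x ↦ (x, f(x)))_# [min(1, f'(x)) dx] + (x ↦ (x, 1−x))_# [max(0, 1 − f'(x)) dx]; then μ_β is a permuton, and the permutons μ_{τ_n} of the 231-avoiding Mallows permutations τ_n = τ_n^{β,231} converge weakly in probability to μ_β, i.e. for every ε > 0 and any metric d metrizing weak convergence of probability measures on [0,1]², P(d(μ_{τ_n}, μ_β) > ε) → 0 as n → ∞. Moreover, if β ≤ 0, the permutons μ_{τ_n} converge weakly in probability to the diagonal permuton (x ↦ (x,x))_# Leb_{[0,1]}. -/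

import Mathlib

open MeasureTheory Filter Set

attribute [local instance] Classical.propDecidable

noncomputable section

/-- Number of inversions of a permutation of `Fin n`. -/
def invCount {n : ℕ} (σ : Equiv.Perm (Fin n)) : ℕ :=
  (Finset.univ.filter (fun p : Fin n × Fin n => p.1 < p.2 ∧ σ p.2 < σ p.1)).card

/-- `σ` avoids the pattern `231`. -/
def Avoids231 {n : ℕ} (σ : Equiv.Perm (Fin n)) : Prop :=
  ¬ ∃ i j k : Fin n, i < j ∧ j < k ∧ σ k < σ i ∧ σ i < σ j

/-- Partition function of the 231-avoiding Mallows model with parameter `e^{β/n}`. -/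
def Z231 (β : ℝ) (n : ℕ) : ℝ :=
  ∑ σ ∈ Finset.univ.filter (fun σ : Equiv.Perm (Fin n) => Avoids231 σ),
    Real.exp (β / n * invCount σ)

/-- A permuton: a Borel probability measure on the plane (supported on `[0,1]²`) whose
two marginals are the Lebesgue measure on `[0,1]`. -/
def IsPermuton (μ : Measure (ℝ × ℝ)) : Prop :=
  IsProbabilityMeasure μ ∧
    μ.map Prod.fst = volume.restrict (Set.Icc (0:ℝ) 1) ∧
    μ.map Prod.snd = volume.restrict (Set.Icc (0:ℝ) 1)

/-- The permuton associated with a permutation: mass `1/n` spread uniformly on each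
cell `[(i-1)/n, i/n] × [(σ(i)-1)/n, σ(i)/n]` (0-indexed below). -/
def permutonOfPerm {n : ℕ} (σ : Equiv.Perm (Fin n)) : Measure (ℝ × ℝ) :=
  (n : ENNReal) • (volume.restrict (⋃ i : Fin n,
    Set.Icc (((i : ℕ) : ℝ) / n) ((((i : ℕ) : ℝ) + 1) / n) ×ˢ
      Set.Icc ((((σ i : Fin n) : ℕ) : ℝ) / n) (((((σ i : Fin n) : ℕ) : ℝ) + 1) / n)))

/-- The diagonal permuton `(x ↦ (x,x))_# Leb_{[0,1]}`. -/
def diagPermuton : Measure (ℝ × ℝ) :=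
  (volume.restrict (Set.Icc (0:ℝ) 1)).map (fun x => (x, x))

/-- `d` metrizes weak convergence of probability measures on `[0,1]²`:
for sequences of probability measures carried by `[0,1]²`, convergence of `d` to `0`
is equivalent to weak convergence. -/
def MetrizesWeakConvUnitSq (d : Measure (ℝ × ℝ) → Measure (ℝ × ℝ) → ℝ) : Prop :=
  ∀ (μs : ℕ → Measure (ℝ × ℝ)) (μ : Measure (ℝ × ℝ)),
    (∀ n, IsProbabilityMeasure (μs n)) → IsProbabilityMeasure μ →
    (∀ n, μs n (Set.Icc (0:ℝ) 1 ×ˢ Set.Icc (0:ℝ) 1) = 1) →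
    μ (Set.Icc (0:ℝ) 1 ×ˢ Set.Icc (0:ℝ) 1) = 1 →
    (Filter.Tendsto (fun n => d (μs n) μ) Filter.atTop (nhds 0) ↔
      ∀ g : BoundedContinuousFunction (ℝ × ℝ) ℝ,
        Filter.Tendsto (fun n => ∫ z, g z ∂(μs n)) Filter.atTop (nhds (∫ z, g z ∂μ)))

/-- The curve `f^{231}_β`. -/
def f231 (β : ℝ) (x : ℝ) : ℝ :=
  1 - (1 / β) * Real.log (1 + Real.exp β - Real.exp (β * x))

/-- The limit permuton `μ^{231}_β`. -/
def mu231 (β : ℝ) : Measure (ℝ × ℝ) :=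
  ((volume.restrict (Set.Icc (0:ℝ) 1)).withDensity
      (fun x => ENNReal.ofReal (min 1 (deriv (f231 β) x)))).map
    (fun x => (x, f231 β x)) +
  ((volume.restrict (Set.Icc (0:ℝ) 1)).withDensity
      (fun x => ENNReal.ofReal (max 0 (1 - deriv (f231 β) x)))).map
    (fun x => (x, 1 - x))

/-- The least value taken by `σ` at positions `≥ k` (and `n` if there is no such position). -/
def tailMin {n : ℕ} (σ : Equiv.Perm (Fin n)) (k : ℕ) : ℕ :=
  sInf {v | v = n ∨ ∃ i : Fin n, k ≤ (i : ℕ) ∧ ((σ i : Fin n) : ℕ) = v}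

/-- The number of positions `< k` at which `σ` takes a value `≥ l`. -/
def exceedCount {n : ℕ} (σ : Equiv.Perm (Fin n)) (k l : ℕ) : ℕ :=
  (Finset.univ.filter (fun i : Fin n => (i : ℕ) < k ∧ l ≤ ((σ i : Fin n) : ℕ))).card

lemma tailMin_mem {n : ℕ} (σ : Equiv.Perm (Fin n)) (k : ℕ) :
    tailMin σ k = n ∨ ∃ i : Fin n, k ≤ (i : ℕ) ∧ ((σ i : Fin n) : ℕ) = tailMin σ k :=
  Nat.sInf_mem (s := {v | v = n ∨ ∃ i : Fin n, k ≤ (i : ℕ) ∧ ((σ i : Fin n) : ℕ) = v})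
    ⟨n, Or.inl rfl⟩

lemma tailMin_le {n : ℕ} (σ : Equiv.Perm (Fin n)) (k : ℕ) : tailMin σ k ≤ n :=
  Nat.sInf_le (Or.inl rfl)

lemma tailMin_le_apply {n : ℕ} (σ : Equiv.Perm (Fin n)) {k : ℕ} {i : Fin n} (h : k ≤ (i : ℕ)) :
    tailMin σ k ≤ σ i :=
  Nat.sInf_le (Or.inr ⟨i, h, rfl⟩)

lemma le_tailMin_iff {n : ℕ} (σ : Equiv.Perm (Fin n)) (k l : ℕ) :
    l ≤ tailMin σ k ↔ l ≤ n ∧ ∀ i : Fin n, k ≤ (i : ℕ) → l ≤ σ i := by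
  constructor
  · intro h
    exact ⟨h.trans (tailMin_le σ k), fun i hi => h.trans (tailMin_le_apply σ hi)⟩
  · rintro ⟨h, h'⟩
    rcases tailMin_mem σ k with h1 | ⟨i, hi, h1⟩
    · omega
    · rw [← h1]; exact h' i hi

lemma tailMin_mono {n : ℕ} (σ : Equiv.Perm (Fin n)) : Monotone (tailMin σ) := by
  intro k k' h
  rw [le_tailMin_iff]
  exact ⟨tailMin_le σ k, fun i hi => tailMin_le_apply σ (h.trans hi)⟩

lemma tailMin_top {n : ℕ} (σ : Equiv.Perm (Fin n)) {k : ℕ} (hk : n ≤ k) : tailMin σ k = n := by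
  rcases tailMin_mem σ k with h | ⟨i, hi, _⟩
  · exact h
  · have := i.2; omega

lemma card_filter_apply_lt {n : ℕ} (σ : Equiv.Perm (Fin n)) {l : ℕ} (hl : l ≤ n) :
    (Finset.univ.filter (fun i : Fin n => ((σ i : Fin n) : ℕ) < l)).card = l := by
  have h : (Finset.univ.filter (fun i : Fin n => (i : ℕ) < l)).card = l := by
    convert Fin.card_filter_val_lt (n := n) (m := l) using 1
    omega
  conv_rhs => rw [← h]
  refine Finset.card_bij (fun i _ => σ i) (by simp) (by simp) ?_
  intro j hj
  exact ⟨σ.symm j, by simpa using hj, by simp⟩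

lemma card_filter_pos_lt {n : ℕ} {l : ℕ} (hl : l ≤ n) :
    (Finset.univ.filter (fun i : Fin n => (i : ℕ) < l)).card = l :=
  card_filter_apply_lt (Equiv.refl _) hl

lemma tailMin_le_self {n : ℕ} (σ : Equiv.Perm (Fin n)) {k : ℕ} (hk : k ≤ n) :
    tailMin σ k ≤ k := by
  rw [← card_filter_apply_lt σ (tailMin_le σ k)]
  conv_rhs => rw [← card_filter_pos_lt hk]
  refine Finset.card_le_card fun i hi => ?_
  simp only [Finset.mem_filter, Finset.mem_univ, true_and] at hi ⊢
  by_contra h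
  exact absurd (tailMin_le_apply σ (not_lt.1 h)) (not_le.2 hi)

/-- Before position `k`, all values below `tailMin σ k` have appeared. -/
lemma exceedCount_add_of_le_tailMin {n : ℕ} (σ : Equiv.Perm (Fin n)) {k l : ℕ} (hk : k ≤ n)
    (hl : l ≤ tailMin σ k) : exceedCount σ k l + l = k := by
  have h1 := card_filter_apply_lt σ (hl.trans (tailMin_le σ k))
  have h2 := card_filter_pos_lt hk
  have h3 : Finset.univ.filter (fun i : Fin n => (i : ℕ) < k) =
      Finset.univ.filter (fun i : Fin n => (i : ℕ) < k ∧ l ≤ ((σ i : Fin n) : ℕ)) ∪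
      Finset.univ.filter (fun i : Fin n => ((σ i : Fin n) : ℕ) < l) := by
    ext i
    have := fun h => hl.trans (tailMin_le_apply σ (k := k) (i := i) h)
    simp only [Finset.mem_filter, Finset.mem_univ, true_and, Finset.mem_union]
    constructor
    · intro h
      by_cases h' : l ≤ (σ i : ℕ)
      · exact Or.inl ⟨h, h'⟩
      · exact Or.inr (by omega)
    · rintro (h | h)
      · exact h.1
      · by_contra h'
        have := this (by omega)
        omega
  rw [h3, Finset.card_union_of_disjoint, h1] at h2
  · exact h2
  · rw [Finset.disjoint_left]
    intro i hi hi'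
    simp only [Finset.mem_filter, Finset.mem_univ, true_and] at hi hi'
    omega

lemma exceedCount_mono_left {n : ℕ} (σ : Equiv.Perm (Fin n)) {k k' l : ℕ} (h : k ≤ k') :
    exceedCount σ k l ≤ exceedCount σ k' l := by
  refine Finset.card_le_card fun i hi => ?_
  simp only [Finset.mem_filter, Finset.mem_univ, true_and] at hi ⊢
  omega

lemma exceedCount_anti_right {n : ℕ} (σ : Equiv.Perm (Fin n)) {k l l' : ℕ} (h : l ≤ l') :
    exceedCount σ k l' ≤ exceedCount σ k l := by
  refine Finset.card_le_card fun i hi => ?_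
  simp only [Finset.mem_filter, Finset.mem_univ, true_and] at hi ⊢
  omega

/-- The first `k` such that all values below `l` appear before position `k`. -/
def lastPos {n : ℕ} (σ : Equiv.Perm (Fin n)) (l : ℕ) : ℕ := sInf {k | l ≤ tailMin σ k}

lemma le_tailMin_lastPos {n : ℕ} (σ : Equiv.Perm (Fin n)) {l : ℕ} (hl : l ≤ n) :
    l ≤ tailMin σ (lastPos σ l) :=
  Nat.sInf_mem (s := {k | l ≤ tailMin σ k}) ⟨n, by simpa [tailMin_top σ le_rfl] using hl⟩

lemma lastPos_le {n : ℕ} (σ : Equiv.Perm (Fin n)) {k l : ℕ} (h : l ≤ tailMin σ k) :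
    lastPos σ l ≤ k := Nat.sInf_le h

lemma lastPos_le_top {n : ℕ} (σ : Equiv.Perm (Fin n)) {l : ℕ} (hl : l ≤ n) :
    lastPos σ l ≤ n := lastPos_le σ (by simpa [tailMin_top σ le_rfl] using hl)

lemma tailMin_lt_of_lt_lastPos {n : ℕ} (σ : Equiv.Perm (Fin n)) {k l : ℕ}
    (h : k < lastPos σ l) : tailMin σ k < l := by
  by_contra h'
  exact absurd (lastPos_le σ (not_lt.1 h')) (not_le.2 h)

lemma exceedCount_add_min_le {n : ℕ} (σ : Equiv.Perm (Fin n)) {k l : ℕ} (hk : k ≤ n) :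
    exceedCount σ k l + min l (tailMin σ k) ≤ k := by
  have := exceedCount_add_of_le_tailMin σ hk (min_le_right l (tailMin σ k))
  have := exceedCount_anti_right σ (k := k) (min_le_left l (tailMin σ k))
  omega

lemma exceedCount_add_le_max {n : ℕ} (σ : Equiv.Perm (Fin n)) {k l : ℕ} (hk : k ≤ n)
    (hl : l ≤ n) : exceedCount σ k l + l ≤ max k (lastPos σ l) := by
  have := exceedCount_add_of_le_tailMin σ (max_le hk (lastPos_le_top σ hl))
    ((le_tailMin_lastPos σ hl).trans (tailMin_mono σ (le_max_right k _)))
  have := exceedCount_mono_left σ (l := l) (le_max_left k (lastPos σ l))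
  omega

lemma exists_le_exceedCount_add {n : ℕ} {σ : Equiv.Perm (Fin n)} (hσ : Avoids231 σ) {k l : ℕ}
    (hk : k ≤ n) (hl : l ≤ n) (hkl : tailMin σ k < l) :
    ∃ K, k ≤ K ∧ K ≤ lastPos σ l ∧ K ≤ exceedCount σ k l + tailMin σ K := by
  have hkK : k ≤ lastPos σ l := by
    by_contra h
    have := le_tailMin_lastPos σ hl
    have := tailMin_mono σ (not_le.1 h).le
    omega
  set V := Finset.univ.filter (fun i : Fin n => (i : ℕ) < k ∧ tailMin σ k ≤ (σ i : ℕ) ∧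
    (σ i : ℕ) < l) with hV
  rcases V.eq_empty_or_nonempty with hE | hN
  · refine ⟨k, le_rfl, hkK, ?_⟩
    have h1 := exceedCount_add_of_le_tailMin σ hk le_rfl
    have h2 : exceedCount σ k (tailMin σ k) ≤ exceedCount σ k l := by
      refine Finset.card_le_card fun i hi => ?_
      simp only [Finset.mem_filter, Finset.mem_univ, true_and] at hi ⊢
      refine ⟨hi.1, ?_⟩
      by_contra h
      have : i ∈ V := by
        simp only [hV, Finset.mem_filter, Finset.mem_univ, true_and]
        omega
      simp [hE] at this
    omega
  · obtain ⟨i, hiV, hmax⟩ := V.exists_max_image (fun i => (σ i : ℕ)) hN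
    simp only [hV, Finset.mem_filter, Finset.mem_univ, true_and] at hiV
    set K := lastPos σ ((σ i : ℕ) + 1) with hK
    have hiK : (σ i : ℕ) + 1 ≤ tailMin σ K := le_tailMin_lastPos σ (σ i).2
    have hkK' : k ≤ K := by
      by_contra h
      have := tailMin_mono σ (not_le.1 h).le
      omega
    have hKn : K ≤ n := lastPos_le_top σ (σ i).2
    refine ⟨K, hkK', lastPos_le σ ?_, ?_⟩
    · exact le_trans (by omega) (le_tailMin_lastPos σ hl)
    have h1 := exceedCount_add_of_le_tailMin σ hKn le_rfl
    have h2 : exceedCount σ K (tailMin σ K) ≤ exceedCount σ k l := by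
      have hkK2 : k < K := by
        rcases hkK'.eq_or_lt with h | h
        · rw [← h] at hiK; omega
        · exact h
      obtain ⟨p, hpK, hp⟩ : ∃ p : Fin n, K - 1 ≤ (p : ℕ) ∧ (σ p : ℕ) ≤ σ i := by
        have := tailMin_lt_of_lt_lastPos σ (k := K - 1) (l := (σ i : ℕ) + 1) (by omega)
        by_contra hcon
        push Not at hcon
        have := (le_tailMin_iff σ (K - 1) ((σ i : ℕ) + 1)).2 ⟨(σ i).2, hcon⟩
        omega
      refine Finset.card_le_card fun j hj => ?_
      simp only [Finset.mem_filter, Finset.mem_univ, true_and] at hj ⊢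
      have hpi : p ≠ i := by rintro rfl; omega
      have hpi' : (σ p : ℕ) ≠ σ i := fun h => hpi (σ.injective (Fin.ext h))
      have hjp : j ≠ p := by rintro rfl; omega
      have hjp' : (j : ℕ) ≠ p := fun h => hjp (Fin.ext h)
      have hji : (j : ℕ) < i := by
        by_contra h
        have hji : (j : ℕ) ≠ i := by
          intro h
          rw [Fin.ext h] at hj
          omega
        refine hσ ⟨i, j, p, ?_, ?_, ?_, ?_⟩ <;> rw [Fin.lt_def] <;> omega
      refine ⟨by omega, ?_⟩
      by_contra h
      have := hmax j (by
        simp only [hV, Finset.mem_filter, Finset.mem_univ, true_and]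
        omega)
      omega
    omega

/-- Left inversions of a `231`-avoiding permutation. -/
lemma card_left_inversions {n : ℕ} {σ : Equiv.Perm (Fin n)} (hσ : Avoids231 σ) (i : Fin n) :
    (Finset.univ.filter (fun j : Fin n => j < i ∧ σ i < σ j)).card + tailMin σ i = i := by
  refine Eq.trans ?_ (exceedCount_add_of_le_tailMin σ i.2.le le_rfl)
  rw [exceedCount]
  congr 2
  ext j
  simp only [Finset.mem_filter, Finset.mem_univ, true_and, Fin.lt_def]
  constructor
  · rintro ⟨h1, h2⟩
    have := tailMin_le_apply σ (le_refl (i : ℕ))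
    omega
  · rintro ⟨h1, h2⟩
    refine ⟨h1, ?_⟩
    by_contra h
    rcases tailMin_mem σ i with h3 | ⟨p, hp, h3⟩
    · have := (σ j).2; omega
    · have hji : (σ j : ℕ) ≠ σ i := fun h => by
        have := σ.injective (Fin.ext h); omega
      have hpj : (σ p : ℕ) ≠ σ j := fun h => by
        have := congrArg Fin.val (σ.injective (Fin.ext h)); omega
      have hpi : (p : ℕ) ≠ i := fun h => by
        rw [Fin.ext h] at h3 hpj; omega
      refine hσ ⟨j, i, p, ?_, ?_, ?_, ?_⟩ <;> rw [Fin.lt_def] <;> omega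

lemma invCount_eq_sum {n : ℕ} (σ : Equiv.Perm (Fin n)) :
    invCount σ = ∑ i, (Finset.univ.filter (fun j : Fin n => j < i ∧ σ i < σ j)).card := by
  simp only [invCount, Finset.card_filter]
  rw [Fintype.sum_prod_type_right]

lemma invCount_add_sum_tailMin {n : ℕ} {σ : Equiv.Perm (Fin n)} (hσ : Avoids231 σ) :
    invCount σ + ∑ i : Fin n, tailMin σ i = ∑ i : Fin n, (i : ℕ) := by
  rw [invCount_eq_sum, ← Finset.sum_add_distrib]
  exact Finset.sum_congr rfl fun i _ => card_left_inversions hσ i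

/-- If more than one position in `[0,k)` has value `≥ l`, there are many inversions. -/
lemma exceedCount_sq_le {n : ℕ} (σ : Equiv.Perm (Fin n)) {k l : ℕ} (hk : k ≤ n) (hkl : k ≤ l)
    (hl : l ≤ n) : exceedCount σ k l * exceedCount σ k l ≤ invCount σ := by
  set A := Finset.univ.filter (fun i : Fin n => (i : ℕ) < k ∧ l ≤ ((σ i : Fin n) : ℕ)) with hA
  set B := Finset.univ.filter (fun i : Fin n => k ≤ (i : ℕ) ∧ ((σ i : Fin n) : ℕ) < l) with hB
  set C := Finset.univ.filter (fun i : Fin n => (i : ℕ) < k ∧ ((σ i : Fin n) : ℕ) < l) with hC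
  have h1 : A.card + C.card = k := by
    rw [← card_filter_pos_lt hk, ← Finset.card_union_of_disjoint]
    · congr 1; ext i; simp [hA, hC]; omega
    · rw [Finset.disjoint_left]; intro i; simp [hA, hC]; omega
  have h2 : B.card + C.card = l := by
    rw [← card_filter_apply_lt σ hl, ← Finset.card_union_of_disjoint]
    · congr 1; ext i; simp [hB, hC]; omega
    · rw [Finset.disjoint_left]; intro i; simp [hB, hC]; omega
  have h3 : A.card * B.card ≤ invCount σ := by
    rw [← Finset.card_product]
    refine Finset.card_le_card fun p hp => ?_
    simp only [hA, hB, Finset.mem_product, Finset.mem_filter, Finset.mem_univ, true_and,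
      Fin.lt_def] at hp ⊢
    omega
  refine le_trans (Nat.mul_le_mul_left _ ?_) h3
  change A.card ≤ B.card
  omega

lemma exceedCount_add_sub_sq_le {n : ℕ} (σ : Equiv.Perm (Fin n)) {k l : ℕ} (hk : k ≤ n)
    (hkl : l ≤ k) :
    ∃ c, exceedCount σ k l + l = k + c ∧ c * c ≤ invCount σ := by
  set A := Finset.univ.filter (fun i : Fin n => (i : ℕ) < k ∧ l ≤ ((σ i : Fin n) : ℕ)) with hA
  set B := Finset.univ.filter (fun i : Fin n => k ≤ (i : ℕ) ∧ ((σ i : Fin n) : ℕ) < l) with hB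
  set C := Finset.univ.filter (fun i : Fin n => (i : ℕ) < k ∧ ((σ i : Fin n) : ℕ) < l) with hC
  have h1 : A.card + C.card = k := by
    rw [← card_filter_pos_lt hk, ← Finset.card_union_of_disjoint]
    · congr 1; ext i; simp [hA, hC]; omega
    · rw [Finset.disjoint_left]; intro i; simp [hA, hC]; omega
  have h2 : B.card + C.card = l := by
    rw [← card_filter_apply_lt σ (hkl.trans hk), ← Finset.card_union_of_disjoint]
    · congr 1; ext i; simp [hB, hC]; omega
    · rw [Finset.disjoint_left]; intro i; simp [hB, hC]; omega
  have h3 : A.card * B.card ≤ invCount σ := by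
    rw [← Finset.card_product]
    refine Finset.card_le_card fun p hp => ?_
    simp only [hA, hB, Finset.mem_product, Finset.mem_filter, Finset.mem_univ, true_and,
      Fin.lt_def] at hp ⊢
    omega
  refine ⟨B.card, ?_, le_trans (Nat.mul_le_mul_right _ ?_) h3⟩
  · change A.card + l = _
    omega
  · omega

/-- The left inversion number of position `i`. -/
def leftInv {n : ℕ} (σ : Equiv.Perm (Fin n)) (i : Fin n) : ℕ :=
  (Finset.univ.filter (fun j : Fin n => j < i ∧ σ i < σ j)).card

/-- The times of the up-steps of the Dyck path of a `231`-avoiding permutation. -/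
def upSteps {n : ℕ} (σ : Equiv.Perm (Fin n)) : Finset ℕ :=
  Finset.univ.image (fun i : Fin n => (i : ℕ) + tailMin σ i)

lemma add_tailMin_strictMono {n : ℕ} (σ : Equiv.Perm (Fin n)) :
    StrictMono (fun k : ℕ => k + tailMin σ k) := by
  intro a b h
  have := tailMin_mono σ h.le
  dsimp only
  omega

lemma upSteps_subset {n : ℕ} (σ : Equiv.Perm (Fin n)) :
    upSteps σ ⊆ Finset.range (2 * n) := by
  intro t ht
  obtain ⟨i, -, rfl⟩ := Finset.mem_image.1 ht
  have := tailMin_le_self σ i.2.le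
  have := i.2
  simp only [Finset.mem_range]
  omega

lemma upSteps_eq_image_range {n : ℕ} (σ : Equiv.Perm (Fin n)) :
    upSteps σ = (Finset.range n).image (fun k : ℕ => k + tailMin σ k) := by
  ext t
  simp only [upSteps, Finset.mem_image, Finset.mem_univ, true_and, Finset.mem_range]
  exact ⟨fun ⟨i, h⟩ => ⟨i, i.2, h⟩, fun ⟨i, hi, h⟩ => ⟨⟨i, hi⟩, h⟩⟩

lemma card_upSteps_filter {n : ℕ} (σ : Equiv.Perm (Fin n)) {k : ℕ} (hk : k ≤ n) :
    ((upSteps σ).filter (· < k + tailMin σ k)).card = k := by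
  have : (upSteps σ).filter (· < k + tailMin σ k) =
      (Finset.range k).image (fun k : ℕ => k + tailMin σ k) := by
    ext t
    simp only [upSteps_eq_image_range, Finset.mem_filter, Finset.mem_image, Finset.mem_range]
    constructor
    · rintro ⟨⟨i, hi, rfl⟩, h⟩
      exact ⟨i, (add_tailMin_strictMono σ).lt_iff_lt.1 h, rfl⟩
    · rintro ⟨i, hi, rfl⟩
      exact ⟨⟨i, by omega, rfl⟩, add_tailMin_strictMono σ hi⟩
  rw [this, Finset.card_image_of_injective _ (add_tailMin_strictMono σ).injective,
    Finset.card_range]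

/-- Inversions of a `231`-avoiding permutation are read off the left inversion numbers. -/
lemma lt_apply_iff_leftInv {n : ℕ} {σ : Equiv.Perm (Fin n)} (hσ : Avoids231 σ) {j i : Fin n}
    (hji : j < i) :
    σ i < σ j ↔ ∀ m, j < m → m ≤ i → leftInv σ j < leftInv σ m := by
  constructor
  · intro h m hjm hmi
    have hmj : σ m < σ j := by
      rcases hmi.eq_or_lt with rfl | hmi
      · exact h
      · by_contra h'
        refine hσ ⟨j, m, i, hjm, hmi, h, lt_of_le_of_ne (not_lt.1 h') ?_⟩
        exact fun e => hjm.ne (σ.injective e)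
    refine Finset.card_lt_card ?_
    rw [Finset.ssubset_iff_of_subset]
    · refine ⟨j, ?_, ?_⟩
      · simp only [Finset.mem_filter, Finset.mem_univ, true_and]
        exact ⟨hjm, hmj⟩
      · simp
    · intro p hp
      simp only [Finset.mem_filter, Finset.mem_univ, true_and] at hp ⊢
      exact ⟨hp.1.trans hjm, hmj.trans hp.2⟩
  · intro h
    by_contra hc
    have hc' : σ j < σ i := lt_of_le_of_ne (not_lt.1 hc) fun e => hji.ne (σ.injective e)
    set S := Finset.univ.filter (fun m : Fin n => j < m ∧ σ j < σ m) with hS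
    have hiS : i ∈ S := by simp [hS, hji, hc']
    obtain ⟨m, hm, hmin⟩ := S.exists_min_image id ⟨i, hiS⟩
    have hm' : j < m ∧ σ j < σ m := by simpa [hS] using hm
    have hle : leftInv σ m ≤ leftInv σ j := by
      refine Finset.card_le_card fun p hp => ?_
      simp only [Finset.mem_filter, Finset.mem_univ, true_and] at hp ⊢
      have hpj : σ j < σ p := hm'.2.trans hp.2
      refine ⟨?_, hpj⟩
      by_contra hjp
      have hjp' : j < p := lt_of_le_of_ne (not_lt.1 hjp) (by rintro rfl; exact lt_irrefl _ hpj)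
      have := hmin p (by simp [hS, hjp', hpj])
      exact absurd hp.1 (not_lt.2 this)
    exact absurd (h m hm'.1 (hmin i hiS)) (not_lt.2 hle)

lemma val_apply_eq_card {n : ℕ} (σ : Equiv.Perm (Fin n)) (i : Fin n) :
    (Finset.univ.filter (fun j => σ j < σ i)).card = (σ i : ℕ) := by
  rw [← card_filter_apply_lt σ (σ i).2.le]
  rfl

lemma eq_of_leftInv_eq {n : ℕ} {σ σ' : Equiv.Perm (Fin n)} (hσ : Avoids231 σ)
    (hσ' : Avoids231 σ') (h : ∀ i, leftInv σ i = leftInv σ' i) : σ = σ' := by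
  have key : ∀ j i : Fin n, j < i → (σ i < σ j ↔ σ' i < σ' j) := by
    intro j i hji
    rw [lt_apply_iff_leftInv hσ hji, lt_apply_iff_leftInv hσ' hji]
    simp only [h]
  have key' : ∀ j i : Fin n, σ j < σ i ↔ σ' j < σ' i := by
    intro j i
    rcases lt_trichotomy j i with hl | rfl | hl
    · have := key j i hl
      have e1 : σ j ≠ σ i := fun e => hl.ne (σ.injective e)
      have e2 : σ' j ≠ σ' i := fun e => hl.ne (σ'.injective e)
      rw [← not_iff_not, not_lt, not_lt, e1.symm.le_iff_lt, e2.symm.le_iff_lt]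
      exact this
    · simp
    · exact key i j hl
  ext i
  rw [← val_apply_eq_card σ i, ← val_apply_eq_card σ' i]
  simp only [key']

lemma leftInv_add_tailMin {n : ℕ} {σ : Equiv.Perm (Fin n)} (hσ : Avoids231 σ) (i : Fin n) :
    leftInv σ i + tailMin σ i = i := card_left_inversions hσ i

lemma upSteps_injOn {n : ℕ} :
    Set.InjOn (upSteps (n := n)) {σ | Avoids231 σ} := by
  intro σ hσ σ' hσ' h
  refine eq_of_leftInv_eq hσ hσ' fun i => ?_
  have hm : ∀ τ : Equiv.Perm (Fin n), StrictMono (fun i : Fin n => (i : ℕ) + tailMin τ i) :=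
    fun τ a b hab => add_tailMin_strictMono τ hab
  have : (fun i : Fin n => (i : ℕ) + tailMin σ i) = fun i : Fin n => (i : ℕ) + tailMin σ' i := by
    refine ((hm σ).range_inj (hm σ')).1 ?_
    have := congrArg (fun s : Finset ℕ => (s : Set ℕ)) h
    simpa [upSteps] using this
  have := congrFun this i
  have := leftInv_add_tailMin hσ i
  have := leftInv_add_tailMin hσ' i
  omega

/-- A sequence `b` with `b 0 = 0` and `b (i + 1) ≤ b i + 1` is the sequence of left inversion
numbers of a `231`-avoiding permutation. -/
lemma exists_avoids_leftInv {n : ℕ} (b : Fin n → ℕ) (h0 : ∀ i : Fin n, (i : ℕ) = 0 → b i = 0)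
    (hs : ∀ i j : Fin n, (j : ℕ) = i + 1 → b j ≤ b i + 1) :
    ∃ σ : Equiv.Perm (Fin n), Avoids231 σ ∧ ∀ i, leftInv σ i = b i := by
  let R : Fin n → Fin n → Prop := fun j i => j < i ∧ ∀ m, j < m → m ≤ i → b j < b m
  let lt' : Fin n → Fin n → Prop := fun i j => (i < j ∧ ¬ R i j) ∨ (j < i ∧ R j i)
  have R_trans : ∀ i j k, R i j → R j k → R i k := by
    rintro i j k ⟨h1, h2⟩ ⟨h3, h4⟩
    refine ⟨h1.trans h3, fun m hm hmk => ?_⟩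
    rcases le_or_gt m j with h | h
    · exact h2 m hm h
    · exact (h2 j h1 le_rfl).trans (h4 m h hmk)
  have R_mid : ∀ i j k, i < j → j < k → R i k → R i j := by
    rintro i j k h1 h2 ⟨h3, h4⟩
    exact ⟨h1, fun m hm hmj => h4 m hm (hmj.trans h2.le)⟩
  have tr : ∀ i j k, lt' i j → lt' j k → lt' i k := by
    rintro i j k (⟨h1, h2⟩ | ⟨h1, h2⟩) (⟨h3, h4⟩ | ⟨h3, h4⟩)
    · exact Or.inl ⟨h1.trans h3, fun h => h2 (R_mid i j k h1 h3 h)⟩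
    · rcases lt_trichotomy i k with h | rfl | h
      · exact Or.inl ⟨h, fun h' => h2 (R_trans i k j h' h4)⟩
      · exact absurd h4 h2
      · exact Or.inr ⟨h, R_mid k i j h h1 h4⟩
    · rcases lt_trichotomy i k with h | rfl | h
      · exact Or.inl ⟨h, fun h' => h4 (R_trans j i k h2 h')⟩
      · exact absurd h2 h4
      · exact absurd (R_mid j k i h3 h h2) h4
    · exact Or.inr ⟨h3.trans h1, R_trans k j i h4 h2⟩
  have irr : ∀ i, ¬ lt' i i := by
    rintro i (⟨h, -⟩ | ⟨h, -⟩) <;> exact lt_irrefl _ h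
  have tot : ∀ i j, i ≠ j → lt' i j ∨ lt' j i := by
    intro i j h
    rcases h.lt_or_gt with h | h
    · by_cases hR : R i j
      · exact Or.inr (Or.inr ⟨h, hR⟩)
      · exact Or.inl (Or.inl ⟨h, hR⟩)
    · by_cases hR : R j i
      · exact Or.inl (Or.inr ⟨h, hR⟩)
      · exact Or.inr (Or.inl ⟨h, hR⟩)
  let v : Fin n → ℕ := fun i => (Finset.univ.filter (fun j => lt' j i)).card
  have v_lt : ∀ i j, lt' i j → v i < v j := by
    intro i j h
    refine Finset.card_lt_card ?_
    rw [Finset.ssubset_iff_of_subset]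
    · exact ⟨i, by simpa using h, by simpa using irr i⟩
    · intro k hk
      simp only [Finset.mem_filter, Finset.mem_univ, true_and] at hk ⊢
      exact tr k i j hk h
  have v_lt_iff : ∀ i j, v i < v j ↔ lt' i j := by
    intro i j
    refine ⟨fun h => ?_, v_lt i j⟩
    by_contra h'
    by_cases hij : i = j
    · subst hij; exact lt_irrefl _ h
    · exact absurd (v_lt j i ((tot i j hij).resolve_left h')) (not_lt.2 h.le)
  have v_bd : ∀ i, v i < n := by
    intro i
    have : (Finset.univ.filter (fun j => lt' j i)).card < (Finset.univ : Finset (Fin n)).card := by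
      refine Finset.card_lt_card ?_
      rw [Finset.ssubset_iff_of_subset (Finset.subset_univ _)]
      exact ⟨i, Finset.mem_univ _, by simpa using irr i⟩
    simpa using this
  let w : Fin n → Fin n := fun i => ⟨v i, v_bd i⟩
  have w_inj : Function.Injective w := by
    intro i j h
    by_contra hij
    have hv : v i = v j := congrArg Fin.val h
    rcases tot i j hij with h | h
    · exact (v_lt i j h).ne hv
    · exact (v_lt j i h).ne hv.symm
  let σ : Equiv.Perm (Fin n) := Equiv.ofBijective w (Finite.injective_iff_bijective.1 w_inj)
  have σ_lt : ∀ i j, σ i < σ j ↔ lt' i j := fun i j => v_lt_iff i j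
  have σ_inv : ∀ j i, j < i → (σ i < σ j ↔ R j i) := by
    intro j i h
    rw [σ_lt]
    constructor
    · rintro (⟨h', -⟩ | ⟨-, h'⟩)
      · exact absurd h' h.asymm
      · exact h'
    · exact fun h' => Or.inr ⟨h, h'⟩
  refine ⟨σ, ?_, fun i => ?_⟩
  · rintro ⟨i, j, k, hij, hjk, h1, h2⟩
    have := R_mid i j k hij hjk ((σ_inv i k (hij.trans hjk)).1 h1)
    exact absurd ((σ_inv i j hij).2 this) h2.asymm
  · rw [leftInv, ← Finset.card_range (b i)]
    refine Finset.card_bij (fun j _ => b j) ?_ ?_ ?_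
    · intro j hj
      simp only [Finset.mem_filter, Finset.mem_univ, true_and] at hj
      have := (σ_inv j i hj.1).1 hj.2
      simpa using this.2 i hj.1 le_rfl
    · intro j hj j' hj' hb
      simp only [Finset.mem_filter, Finset.mem_univ, true_and] at hj hj'
      have h1 := (σ_inv j i hj.1).1 hj.2
      have h2 := (σ_inv j' i hj'.1).1 hj'.2
      rcases lt_trichotomy j j' with h | h | h
      · exact absurd (h1.2 j' h hj'.1.le) (by omega)
      · exact h
      · exact absurd (h2.2 j h hj.1.le) (by omega)
    · intro l hl
      simp only [Finset.mem_range] at hl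
      set S := Finset.univ.filter (fun j : Fin n => j < i ∧ b j ≤ l) with hS
      have hne : S.Nonempty := by
        refine ⟨⟨0, i.pos⟩, ?_⟩
        have hz := h0 ⟨0, i.pos⟩ rfl
        simp only [hS, Finset.mem_filter, Finset.mem_univ, true_and, hz, Nat.zero_le, and_true]
        rw [Fin.lt_def]
        rcases Nat.eq_zero_or_pos (i : ℕ) with h | h
        · have := h0 i h; omega
        · exact h
      obtain ⟨j, hj, hmax⟩ := S.exists_max_image id hne
      have hj' : j < i ∧ b j ≤ l := by simpa [hS] using hj
      have hgt : ∀ m, j < m → m ≤ i → l < b m := by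
        intro m hm hmi
        by_contra hc
        rcases hmi.eq_or_lt with rfl | hmi
        · omega
        · have := hmax m (by simp [hS, hmi]; omega)
          exact absurd hm (not_lt.2 this)
      have hn : (j : ℕ) + 1 ≤ i := hj'.1
      have hsucc := hs j ⟨(j : ℕ) + 1, by have := i.2; omega⟩ rfl
      have hg := hgt ⟨(j : ℕ) + 1, by have := i.2; omega⟩ (by simp [Fin.lt_def])
        (by rw [Fin.le_def]; exact hn)
      have hbj : b j = l := by omega
      refine ⟨j, ?_, hbj⟩
      simp only [Finset.mem_filter, Finset.mem_univ, true_and]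
      exact ⟨hj'.1, (σ_inv j i hj'.1).2 ⟨hj'.1, fun m h1 h2 => hbj ▸ hgt m h1 h2⟩⟩

/-- Every Dyck path comes from a `231`-avoiding permutation. -/
lemma exists_upSteps_eq {n : ℕ} {U : Finset ℕ} (hU : U ⊆ Finset.range (2 * n))
    (hcard : U.card = n) (hpos : ∀ t ≤ 2 * n, t ≤ 2 * (U.filter (· < t)).card) :
    ∃ σ : Equiv.Perm (Fin n), Avoids231 σ ∧ upSteps σ = U := by
  let e := U.orderEmbOfFin hcard
  have hcount : ∀ i : Fin n, (U.filter (· < e i)).card = i := by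
    intro i
    have : U.filter (· < e i) = (Finset.univ.filter (fun j : Fin n => (j : ℕ) < i)).image e := by
      ext t
      simp only [Finset.mem_filter, Finset.mem_image, Finset.mem_univ, true_and]
      constructor
      · rintro ⟨h1, h2⟩
        obtain ⟨j, rfl⟩ : t ∈ Set.range e := by
          rw [Finset.range_orderEmbOfFin]; exact h1
        exact ⟨j, e.lt_iff_lt.1 h2, rfl⟩
      · rintro ⟨j, hj, rfl⟩
        exact ⟨Finset.orderEmbOfFin_mem U hcard j, e.lt_iff_lt.2 hj⟩
    rw [this, Finset.card_image_of_injective _ e.injective, card_filter_pos_lt i.2.le]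
  have he : ∀ i : Fin n, e i ≤ 2 * i := by
    intro i
    have h1 : e i < 2 * n := Finset.mem_range.1 (hU (Finset.orderEmbOfFin_mem U hcard i))
    have := hpos (e i) h1.le
    rwa [hcount] at this
  obtain ⟨σ, hσ, hb⟩ := exists_avoids_leftInv (fun i => 2 * i - e i)
    (fun i hi => by simp [hi]) (fun i j hij => by
      have h1 : e i < e j := e.lt_iff_lt.2 (by rw [Fin.lt_def]; omega)
      have := he i
      have := he j
      omega)
  refine ⟨σ, hσ, ?_⟩
  have : ∀ i : Fin n, (i : ℕ) + tailMin σ i = e i := by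
    intro i
    have h1 := leftInv_add_tailMin hσ i
    have h2 := hb i
    have h3 := he i
    omega
  rw [upSteps, Finset.image_congr (g := e) fun i _ => this i]
  apply Finset.coe_injective
  rw [Finset.coe_image, Finset.coe_univ, Set.image_univ, Finset.range_orderEmbOfFin]

/-- The tilted odds of an up-step at time `j`. -/
def odds (β : ℝ) (n : ℕ) (j : ℕ) : ℝ := Real.exp (β / n * (n - 1 / 2 - j))

lemma odds_pos (β : ℝ) (n j : ℕ) : 0 < odds β n j := Real.exp_pos _

lemma prod_odds_upSteps {n : ℕ} (hn : 1 ≤ n) (β : ℝ) {σ : Equiv.Perm (Fin n)}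
    (hσ : Avoids231 σ) :
    ∏ j ∈ upSteps σ, odds β n j = Real.exp (β / 2) * Real.exp (β / n * invCount σ) := by
  rw [upSteps, Finset.prod_image fun i _ j _ h => Fin.ext ((add_tailMin_strictMono σ).injective h)]
  simp only [odds]
  rw [← Real.exp_sum, ← Real.exp_add, ← Finset.mul_sum]
  congr 1
  have h1 : (invCount σ : ℝ) + ∑ i : Fin n, (tailMin σ i : ℝ) = ∑ i : Fin n, ((i : ℕ) : ℝ) := by
    exact_mod_cast invCount_add_sum_tailMin hσ
  have h2 : ∑ i : Fin n, ((i : ℕ) : ℝ) = n * (n - 1) / 2 := by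
    rw [Fin.sum_univ_eq_sum_range (fun i => (i : ℝ)) n]
    have := Finset.sum_range_id_mul_two n
    have h3 : (∑ i ∈ Finset.range n, (i : ℝ)) * 2 = n * (n - 1) := by
      have h4 : ((n - 1 : ℕ) : ℝ) = n - 1 := by push_cast [hn]; ring
      rw [← h4, ← Nat.cast_sum]
      exact_mod_cast this
    linarith
  have hn' : (n : ℝ) ≠ 0 := by positivity
  push_cast
  simp only [Finset.sum_sub_distrib, Finset.sum_add_distrib, Finset.sum_const, Finset.card_univ,
    Fintype.card_fin, nsmul_eq_mul]
  have h5 : ∑ i : Fin n, (tailMin σ i : ℝ) = n * (n - 1) / 2 - invCount σ := by linarith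
  rw [h5, h2]
  field_simp
  ring

/-- Mean number of elements below `t` of a random set with independent odds `w`. -/
def meanCount (w : ℕ → ℝ) (t : ℕ) : ℝ := ∑ j ∈ Finset.range t, w j / (1 + w j)

lemma one_add_exp_mul_le {w s : ℝ} (hw : 0 < w) (hs : |s| ≤ 1) :
    1 + Real.exp s * w ≤ (1 + w) * Real.exp (s * (w / (1 + w)) + s ^ 2) := by
  have h1 : Real.exp s ≤ 1 + s + s ^ 2 := by
    have := (abs_le.1 (Real.abs_exp_sub_one_sub_id_le hs)).2
    linarith
  have hw' : 0 < 1 + w := by linarith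
  have h2 : s * (w / (1 + w)) + s ^ 2 + 1 ≤ Real.exp (s * (w / (1 + w)) + s ^ 2) :=
    Real.add_one_le_exp _
  calc 1 + Real.exp s * w ≤ 1 + (1 + s + s ^ 2) * w := by gcongr
    _ ≤ (1 + w) * (s * (w / (1 + w)) + s ^ 2 + 1) := by
      have : (1 + w) * (s * (w / (1 + w)) + s ^ 2 + 1) = 1 + (1 + s + s ^ 2) * w + s ^ 2 := by
        field_simp
        ring
      rw [this]
      nlinarith [sq_nonneg s]
    _ ≤ _ := by gcongr

lemma sum_exp_card_mul_prod_le {w : ℕ → ℝ} (hw : ∀ j, 0 < w j) {N t : ℕ} (ht : t ≤ N) {s : ℝ}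
    (hs : |s| ≤ 1) :
    ∑ U ∈ (Finset.range N).powerset,
        Real.exp (s * (U.filter (· < t)).card) * ∏ j ∈ U, w j ≤
      (∏ j ∈ Finset.range N, (1 + w j)) * Real.exp (s * meanCount w t + s ^ 2 * t) := by
  have h1 : ∀ U : Finset ℕ, Real.exp (s * (U.filter (· < t)).card) * ∏ j ∈ U, w j =
      ∏ j ∈ U, (if j < t then Real.exp s * w j else w j) := by
    intro U
    have : Real.exp (s * (U.filter (· < t)).card) = ∏ j ∈ U, if j < t then Real.exp s else 1 := by
      rw [← Finset.prod_filter, Finset.prod_const, ← Real.exp_nat_mul, mul_comm]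
    rw [this, ← Finset.prod_mul_distrib]
    refine Finset.prod_congr rfl fun j _ => ?_
    split_ifs <;> simp
  simp only [h1]
  rw [← Finset.prod_one_add]
  have h2 : Real.exp (s * meanCount w t + s ^ 2 * t) =
      ∏ j ∈ Finset.range N, Real.exp (if j < t then s * (w j / (1 + w j)) + s ^ 2 else 0) := by
    rw [← Real.exp_sum, ← Finset.sum_filter]
    congr 1
    have : (Finset.range N).filter (· < t) = Finset.range t := by
      ext j; simp; omega
    rw [this, Finset.sum_add_distrib, ← Finset.mul_sum, meanCount]
    simp [mul_comm]
  rw [h2, ← Finset.prod_mul_distrib]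
  refine Finset.prod_le_prod (fun j _ => ?_) fun j _ => ?_
  · have := hw j
    split_ifs <;> positivity
  · split_ifs
    · exact one_add_exp_mul_le (hw j) hs
    · simp

/-- Chernoff bound for a random set with independent odds `w`. -/
lemma sum_deviation_le {w : ℕ → ℝ} (hw : ∀ j, 0 < w j) {N t : ℕ} (ht : t ≤ N) {s a : ℝ}
    (hs0 : 0 ≤ s) (hs : s ≤ 1) :
    ∑ U ∈ (Finset.range N).powerset.filter
        (fun U => a < |((U.filter (· < t)).card : ℝ) - meanCount w t|), ∏ j ∈ U, w j ≤
      2 * (∏ j ∈ Finset.range N, (1 + w j)) * Real.exp (s ^ 2 * N - s * a) := by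
  have hW : 0 ≤ ∏ j ∈ Finset.range N, (1 + w j) :=
    Finset.prod_nonneg fun j _ => by linarith [hw j]
  have hpos : ∀ U : Finset ℕ, 0 ≤ ∏ j ∈ U, w j := fun U => Finset.prod_nonneg fun j _ => (hw j).le
  set m := meanCount w t
  have e1 := sum_exp_card_mul_prod_le hw ht (s := s) (by rw [abs_of_nonneg hs0]; exact hs)
  have e2 := sum_exp_card_mul_prod_le hw ht (s := -s) (by rw [abs_neg, abs_of_nonneg hs0]; exact hs)
  calc _ ≤ ∑ U ∈ (Finset.range N).powerset,
        (Real.exp (-(s * m) - s * a) * (Real.exp (s * (U.filter (· < t)).card) * ∏ j ∈ U, w j) +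
        Real.exp (s * m - s * a) * (Real.exp (-s * (U.filter (· < t)).card) * ∏ j ∈ U, w j)) := by
        refine (Finset.sum_le_sum fun U hU => ?_).trans
          (Finset.sum_le_sum_of_subset_of_nonneg (Finset.filter_subset _ _) fun U _ _ => ?_)
        · have hU := (Finset.mem_filter.1 hU).2
          rw [← mul_assoc, ← mul_assoc, ← Real.exp_add, ← Real.exp_add, ← add_mul]
          refine le_mul_of_one_le_left (hpos U) ?_
          rcases lt_abs.1 hU with h | h
          · refine le_add_of_le_of_nonneg (Real.one_le_exp ?_) (Real.exp_pos _).le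
            nlinarith
          · refine le_add_of_nonneg_of_le (Real.exp_pos _).le (Real.one_le_exp ?_)
            nlinarith
        · have := hpos U
          positivity
    _ = Real.exp (-(s * m) - s * a) * ∑ U ∈ (Finset.range N).powerset,
          (Real.exp (s * (U.filter (· < t)).card) * ∏ j ∈ U, w j) +
        Real.exp (s * m - s * a) * ∑ U ∈ (Finset.range N).powerset,
          (Real.exp (-s * (U.filter (· < t)).card) * ∏ j ∈ U, w j) := by
        rw [Finset.sum_add_distrib, Finset.mul_sum, Finset.mul_sum]
    _ ≤ Real.exp (-(s * m) - s * a) * ((∏ j ∈ Finset.range N, (1 + w j)) *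
          Real.exp (s * m + s ^ 2 * t)) +
        Real.exp (s * m - s * a) * ((∏ j ∈ Finset.range N, (1 + w j)) *
          Real.exp (-s * m + (-s) ^ 2 * t)) := by gcongr
    _ = 2 * (∏ j ∈ Finset.range N, (1 + w j)) * Real.exp (s ^ 2 * t - s * a) := by
        have h1 : Real.exp (s ^ 2 * t - s * a) =
            Real.exp (-(s * m) - s * a) * Real.exp (s * m + s ^ 2 * t) := by
          rw [← Real.exp_add]; congr 1; ring
        have h2 : Real.exp (s ^ 2 * t - s * a) =
            Real.exp (s * m - s * a) * Real.exp (-s * m + (-s) ^ 2 * t) := by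
          rw [← Real.exp_add]; congr 1; ring
        linear_combination -(∏ j ∈ Finset.range N, (1 + w j)) * h1 -
          (∏ j ∈ Finset.range N, (1 + w j)) * h2
    _ ≤ _ := by gcongr

/-- The initial segments up to time `m` of the path with up-steps `A` are nonnegative. -/
def NonnegUpTo (m : ℕ) (A : Finset ℕ) : Prop := ∀ t ≤ m, t ≤ 2 * (A.filter (· < t)).card

lemma filter_lt_of_subset_range {m : ℕ} {A : Finset ℕ} (hA : A ⊆ Finset.range m) :
    A.filter (· < m) = A :=
  Finset.filter_true_of_mem fun _ hj => Finset.mem_range.1 (hA hj)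

lemma nonnegUpTo_succ_iff {m : ℕ} {A : Finset ℕ} (hA : A ⊆ Finset.range m) :
    NonnegUpTo (m + 1) A ↔ NonnegUpTo m A ∧ m + 1 ≤ 2 * A.card := by
  have h : A.filter (· < m + 1) = A :=
    filter_lt_of_subset_range (hA.trans (Finset.range_mono (Nat.le_succ m)))
  constructor
  · intro H
    refine ⟨fun t ht => H t (by omega), ?_⟩
    have := H (m + 1) le_rfl
    rwa [h] at this
  · rintro ⟨H, H'⟩ t ht
    rcases Nat.le_succ_iff.1 ht with ht | rfl
    · exact H t ht
    · rwa [h]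

lemma nonnegUpTo_succ_insert_iff {m : ℕ} {A : Finset ℕ} (hA : A ⊆ Finset.range m) :
    NonnegUpTo (m + 1) (insert m A) ↔ NonnegUpTo m A := by
  have hm : m ∉ A := fun h => absurd (hA h) (by simp)
  have h1 : ∀ t ≤ m, (insert m A).filter (· < t) = A.filter (· < t) := by
    intro t ht
    rw [Finset.filter_insert, if_neg (by omega)]
  have h2 : (insert m A).filter (· < m + 1) = insert m A := by
    refine filter_lt_of_subset_range ?_
    rw [Finset.range_add_one]
    exact Finset.insert_subset_insert _ hA
  constructor
  · intro H t ht
    rw [← h1 t ht]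
    exact H t (by omega)
  · intro H t ht
    rcases Nat.le_succ_iff.1 ht with ht | rfl
    · rw [h1 t ht]; exact H t ht
    · have := H m le_rfl
      rw [filter_lt_of_subset_range hA] at this
      rw [Nat.succ_eq_add_one, h2, Finset.card_insert_of_notMem hm]
      omega

lemma prod_le_sum_nonneg_mul_height {w : ℕ → ℝ} (m : ℕ) (hw : ∀ j < m, 1 ≤ w j) :
    ∏ j ∈ Finset.range m, (1 + w j) ≤
      ∑ A ∈ (Finset.range m).powerset,
        if NonnegUpTo m A then (∏ j ∈ A, w j) * (2 * A.card - m + 1 : ℝ) else 0 := by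
  induction m with
  | zero => simp [NonnegUpTo]
  | succ m ih =>
    have ih := ih fun j hj => hw j (by omega)
    have hwm := hw m (by omega)
    rw [Finset.prod_range_succ, Finset.range_add_one,
      Finset.sum_powerset_insert (by simp), ← Finset.sum_add_distrib]
    refine (mul_le_mul_of_nonneg_right ih (by linarith)).trans ?_
    rw [Finset.sum_mul]
    refine Finset.sum_le_sum fun A hA => ?_
    have hA := Finset.mem_powerset.1 hA
    have hm : m ∉ A := fun h => absurd (hA h) (by simp)
    rw [nonnegUpTo_succ_iff hA, nonnegUpTo_succ_insert_iff hA, Finset.prod_insert hm,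
      Finset.card_insert_of_notMem hm]
    by_cases hp : NonnegUpTo m A
    · have h1 : m ≤ 2 * A.card := by
        simpa [filter_lt_of_subset_range hA] using hp m le_rfl
      have hP : 0 ≤ ∏ j ∈ A, w j := Finset.prod_nonneg fun j hj => by
        have := hw j (by have := Finset.mem_range.1 (hA hj); omega)
        linarith
      simp only [hp, true_and, if_true]
      have h1' : (m : ℝ) ≤ 2 * A.card := by exact_mod_cast h1
      have h3 : (if m + 1 ≤ 2 * A.card then (∏ j ∈ A, w j) * (2 * A.card - ((m + 1 : ℕ) : ℝ) + 1)
          else 0) = (∏ j ∈ A, w j) * (2 * A.card - m : ℝ) := by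
        split_ifs with h
        · push_cast; ring
        · have : (m : ℝ) = 2 * A.card := by
            have : m = 2 * A.card := by omega
            exact_mod_cast this
          rw [this]; simp
      rw [h3]
      push_cast
      nlinarith [mul_nonneg hP (sub_nonneg.2 hwm)]
    · simp [hp]

/-- Up-steps of the path obtained by following the path of `A` and then the reversal of the path
of `B`. -/
def gluePath (n : ℕ) (A B : Finset ℕ) : Finset ℕ :=
  A ∪ (Finset.range n \ B).image (fun j => 2 * n - 1 - j)

lemma reflect_injOn (n : ℕ) :
    Set.InjOn (fun j : ℕ => 2 * n - 1 - j) (Finset.range n : Set ℕ) := by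
  intro i hi j hj h
  simp at hi hj h
  omega

lemma gluePath_disjoint {n : ℕ} {A : Finset ℕ} (hA : A ⊆ Finset.range n) (B : Finset ℕ) :
    Disjoint A ((Finset.range n \ B).image (fun j => 2 * n - 1 - j)) := by
  rw [Finset.disjoint_left]
  intro t ht ht'
  obtain ⟨j, hj, rfl⟩ := Finset.mem_image.1 ht'
  have h1 := Finset.mem_range.1 (hA ht)
  have h2 := Finset.mem_range.1 (Finset.mem_sdiff.1 hj).1
  omega

lemma gluePath_subset {n : ℕ} {A : Finset ℕ} (hA : A ⊆ Finset.range n) (B : Finset ℕ) :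
    gluePath n A B ⊆ Finset.range (2 * n) := by
  intro t ht
  rcases Finset.mem_union.1 ht with h | h
  · have := Finset.mem_range.1 (hA h)
    simp; omega
  · obtain ⟨j, hj, rfl⟩ := Finset.mem_image.1 h
    have h2 := Finset.mem_range.1 (Finset.mem_sdiff.1 hj).1
    simp; omega

lemma card_gluePath {n : ℕ} {A B : Finset ℕ} (hA : A ⊆ Finset.range n) (hB : B ⊆ Finset.range n)
    (h : A.card = B.card) : (gluePath n A B).card = n := by
  rw [gluePath, Finset.card_union_of_disjoint (gluePath_disjoint hA B),
    Finset.card_image_of_injOn ((reflect_injOn n).mono (by simp)),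
    Finset.card_sdiff_of_subset hB, h]
  have := Finset.card_le_card hB
  simp at this ⊢
  omega

lemma nonnegUpTo_gluePath {n : ℕ} {A B : Finset ℕ} (hA : A ⊆ Finset.range n)
    (hB : B ⊆ Finset.range n) (h : A.card = B.card) (hA' : NonnegUpTo n A)
    (hB' : NonnegUpTo n B) : NonnegUpTo (2 * n) (gluePath n A B) := by
  intro t ht
  rcases le_or_gt t n with htn | htn
  · refine (hA' t htn).trans (Nat.mul_le_mul_left _ (Finset.card_le_card ?_))
    exact Finset.filter_subset_filter _ Finset.subset_union_left
  · obtain ⟨r, rfl⟩ : ∃ r, t = 2 * n - r := ⟨2 * n - t, by omega⟩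
    have hr : 2 * n - (2 * n - r) < n := by omega
    rcases le_or_gt r (2 * n) with hr2 | hr2
    swap
    · omega
    have hr : r < n := by omega
    have h1 : (gluePath n A B).filter (· < 2 * n - r) =
        A ∪ ((Finset.range n \ B).filter (r ≤ ·)).image (fun j => 2 * n - 1 - j) := by
      ext t
      simp only [gluePath, Finset.mem_filter, Finset.mem_union, Finset.mem_image,
        Finset.mem_sdiff, Finset.mem_range]
      constructor
      · rintro ⟨h | ⟨j, ⟨hj, hj'⟩, rfl⟩, h2⟩
        · exact Or.inl h
        · exact Or.inr ⟨j, ⟨⟨hj, hj'⟩, by omega⟩, rfl⟩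
      · rintro (h | ⟨j, ⟨⟨hj, hj'⟩, hr⟩, rfl⟩)
        · have := Finset.mem_range.1 (hA h)
          exact ⟨Or.inl h, by omega⟩
        · exact ⟨Or.inr ⟨j, ⟨hj, hj'⟩, rfl⟩, by omega⟩
    have hd : Disjoint A (((Finset.range n \ B).filter (r ≤ ·)).image (fun j => 2 * n - 1 - j)) :=
      (gluePath_disjoint hA B).mono_right (Finset.image_subset_image (Finset.filter_subset _ _))
    rw [h1, Finset.card_union_of_disjoint hd,
      Finset.card_image_of_injOn ((reflect_injOn n).mono (by intro j; simp; tauto))]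
    have h2 : (Finset.range n \ B).filter (r ≤ ·) =
        ((Finset.range n).filter (r ≤ ·)) \ (B.filter (r ≤ ·)) := by
      ext j
      simp only [Finset.mem_filter, Finset.mem_sdiff]
      tauto
    have h3 : (Finset.range n).filter (r ≤ ·) = Finset.Ico r n := by
      ext j; simp; tauto
    have h4 : B.filter (r ≤ ·) ⊆ (Finset.range n).filter (r ≤ ·) :=
      Finset.filter_subset_filter _ hB
    have h5 : (B.filter (· < r)).card + (B.filter (r ≤ ·)).card = B.card := by
      rw [← Finset.card_filter_add_card_filter_not (s := B) (· < r)]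
      simp only [not_lt]
    have h6 := Finset.card_le_card h4
    rw [h2, Finset.card_sdiff_of_subset h4, h3] at *
    rw [Nat.card_Ico] at *
    have := hB' r hr.le
    omega

lemma prod_gluePath {n : ℕ} {w : ℕ → ℝ}
    (hsym : ∀ j < n, w j * w (2 * n - 1 - j) = 1) {A B : Finset ℕ} (hA : A ⊆ Finset.range n)
    (hB : B ⊆ Finset.range n) :
    (∏ j ∈ Finset.range n, w j) * ∏ j ∈ gluePath n A B, w j =
      (∏ j ∈ A, w j) * ∏ j ∈ B, w j := by
  rw [gluePath, Finset.prod_union (gluePath_disjoint hA B),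
    Finset.prod_image ((reflect_injOn n).mono (by simp)), ← Finset.prod_sdiff hB]
  have : (∏ j ∈ Finset.range n \ B, w j) * ∏ j ∈ Finset.range n \ B, w (2 * n - 1 - j) = 1 := by
    rw [← Finset.prod_mul_distrib]
    refine Finset.prod_eq_one fun j hj => hsym j ?_
    exact Finset.mem_range.1 (Finset.mem_sdiff.1 hj).1
  linear_combination ((∏ j ∈ A, w j) * ∏ j ∈ B, w j) * this

lemma gluePath_inj {n : ℕ} {A B A' B' : Finset ℕ} (hA : A ⊆ Finset.range n)
    (hB : B ⊆ Finset.range n) (hA' : A' ⊆ Finset.range n) (hB₁ : B' ⊆ Finset.range n)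
    (h : gluePath n A B = gluePath n A' B') : A = A' ∧ B = B' := by
  have key : ∀ A B : Finset ℕ, A ⊆ Finset.range n → B ⊆ Finset.range n → ∀ j < n,
      (j ∈ A ↔ j ∈ gluePath n A B) ∧ (j ∈ B ↔ 2 * n - 1 - j ∉ gluePath n A B) := by
    intro A B hA hB j hj
    simp only [gluePath, Finset.mem_union, Finset.mem_image, Finset.mem_sdiff, Finset.mem_range]
    constructor
    · refine ⟨Or.inl, ?_⟩
      rintro (h | ⟨i, ⟨hi, -⟩, h⟩)
      · exact h
      · omega
    · constructor
      · rintro h (h' | ⟨i, ⟨hi, hi'⟩, h'⟩)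
        · have := Finset.mem_range.1 (hA h'); omega
        · have : i = j := by omega
          exact hi' (this ▸ h)
      · intro h
        by_contra hc
        exact h (Or.inr ⟨j, ⟨hj, hc⟩, rfl⟩)
  constructor <;> ext j <;> by_cases hj : j < n
  · rw [(key A B hA hB j hj).1, (key A' B' hA' hB₁ j hj).1, h]
  · exact ⟨fun h => absurd (Finset.mem_range.1 (hA h)) hj,
      fun h => absurd (Finset.mem_range.1 (hA' h)) hj⟩
  · rw [(key A B hA hB j hj).2, (key A' B' hA' hB₁ j hj).2, h]
  · exact ⟨fun h => absurd (Finset.mem_range.1 (hB h)) hj,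
      fun h => absurd (Finset.mem_range.1 (hB₁ h)) hj⟩

/-- The sets of up-steps of Dyck paths of length `2 * n`. -/
def dyckPaths (n : ℕ) : Finset (Finset ℕ) :=
  (Finset.range (2 * n)).powerset.filter (fun U => U.card = n ∧ NonnegUpTo (2 * n) U)

lemma prod_le_sum_dyckPaths {n : ℕ} {w : ℕ → ℝ} (hw : ∀ j, 0 < w j) (hw1 : ∀ j < n, 1 ≤ w j)
    (hsym : ∀ j < n, w j * w (2 * n - 1 - j) = 1) :
    ∏ j ∈ Finset.range (2 * n), (1 + w j) ≤
      (n + 1) ^ 4 * ∑ U ∈ dyckPaths n, ∏ j ∈ U, w j := by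
  set P := ∏ j ∈ Finset.range n, w j with hP
  have hP0 : 0 < P := Finset.prod_pos fun j _ => hw j
  have hpos : ∀ U : Finset ℕ, 0 ≤ ∏ j ∈ U, w j := fun U => Finset.prod_nonneg fun j _ => (hw j).le
  set Q := ∏ j ∈ Finset.range n, (1 + w j) with hQ
  have hQ0 : 0 < Q := Finset.prod_pos fun j _ => by linarith [hw j]
  have h1 : P * ∏ j ∈ Finset.range (2 * n), (1 + w j) = Q ^ 2 := by
    have e1 : ∏ j ∈ Finset.range (2 * n), (1 + w j) =
        Q * ∏ j ∈ Finset.range n, (1 + w (2 * n - 1 - j)) := by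
      rw [two_mul, Finset.prod_range_add]
      congr 1
      rw [← Finset.prod_range_reflect]
      refine Finset.prod_congr rfl fun j hj => ?_
      have := Finset.mem_range.1 hj
      congr 2
      omega
    rw [e1, sq, mul_left_comm, hP, ← Finset.prod_mul_distrib]
    congr 1
    refine Finset.prod_congr rfl fun j hj => ?_
    linear_combination hsym j (Finset.mem_range.1 hj)
  set T := (Finset.range n).powerset.filter (NonnegUpTo n) with hT
  set S := ∑ A ∈ T, ∏ j ∈ A, w j with hS
  have h2 : Q ≤ (n + 1) * S := by
    refine (prod_le_sum_nonneg_mul_height n hw1).trans ?_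
    rw [← Finset.sum_filter, hS, Finset.mul_sum]
    refine Finset.sum_le_sum fun A hA => ?_
    rw [mul_comm]
    refine mul_le_mul_of_nonneg_right ?_ (hpos A)
    have : A.card ≤ n := by
      simpa using Finset.card_le_card (Finset.mem_powerset.1 (Finset.mem_filter.1 hA).1)
    have : (A.card : ℝ) ≤ n := by exact_mod_cast this
    linarith
  have h3 : ∑ a ∈ Finset.range (n + 1), ∑ A ∈ T with A.card = a, ∏ j ∈ A, w j = S := by
    refine Finset.sum_fiberwise_of_maps_to (fun A hA => ?_) _
    have : A.card ≤ n := by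
      simpa using Finset.card_le_card (Finset.mem_powerset.1 (Finset.mem_filter.1 hA).1)
    simp; omega
  obtain ⟨a, -, ha⟩ : ∃ a ∈ Finset.range (n + 1),
      S / (n + 1) ≤ ∑ A ∈ T with A.card = a, ∏ j ∈ A, w j := by
    refine Finset.exists_le_of_sum_le ⟨0, by simp⟩ ?_
    rw [h3]
    simp only [Finset.sum_const, Finset.card_range, nsmul_eq_mul]
    push_cast
    rw [mul_div_cancel₀]
    positivity
  set Ta := T.filter (fun A => A.card = a) with hTa
  set Sa := ∑ A ∈ Ta, ∏ j ∈ A, w j with hSa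
  have hTa' : ∀ A ∈ Ta, A ⊆ Finset.range n ∧ NonnegUpTo n A ∧ A.card = a := by
    intro A hA
    simp only [hTa, hT, Finset.mem_filter, Finset.mem_powerset] at hA
    tauto
  have h4 : Sa ^ 2 ≤ P * ∑ U ∈ dyckPaths n, ∏ j ∈ U, w j := by
    rw [sq, hSa, Finset.sum_mul_sum, ← Finset.sum_product', Finset.mul_sum]
    have e : ∀ p ∈ Ta ×ˢ Ta, (∏ j ∈ p.1, w j) * (∏ j ∈ p.2, w j) =
        P * ∏ j ∈ gluePath n p.1 p.2, w j := by
      intro p hp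
      obtain ⟨h1, h2⟩ := Finset.mem_product.1 hp
      exact (prod_gluePath hsym (hTa' _ h1).1 (hTa' _ h2).1).symm
    rw [Finset.sum_congr rfl e,
      ← Finset.sum_image (s := Ta ×ˢ Ta) (g := fun p => gluePath n p.1 p.2)
        (f := fun U => P * ∏ j ∈ U, w j)]
    · refine Finset.sum_le_sum_of_subset_of_nonneg (fun U hU => ?_) fun U _ _ => ?_
      · obtain ⟨p, hp, rfl⟩ := Finset.mem_image.1 hU
        obtain ⟨h1, h2⟩ := Finset.mem_product.1 hp
        obtain ⟨a1, a2, a3⟩ := hTa' _ h1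
        obtain ⟨b1, b2, b3⟩ := hTa' _ h2
        simp only [dyckPaths, Finset.mem_filter, Finset.mem_powerset]
        exact ⟨gluePath_subset a1 _, card_gluePath a1 b1 (a3.trans b3.symm),
          nonnegUpTo_gluePath a1 b1 (a3.trans b3.symm) a2 b2⟩
      · exact mul_nonneg hP0.le (hpos U)
    · intro p hp q hq h
      obtain ⟨h1, h2⟩ := Finset.mem_product.1 hp
      obtain ⟨h3, h4⟩ := Finset.mem_product.1 hq
      obtain ⟨e1, e2⟩ := gluePath_inj (hTa' _ h1).1 (hTa' _ h2).1 (hTa' _ h3).1 (hTa' _ h4).1 h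
      exact Prod.ext e1 e2
  have hn : (0 : ℝ) < n + 1 := by positivity
  have h5 : Q ≤ (n + 1) ^ 2 * Sa := by
    have := (div_le_iff₀ hn).1 ha
    nlinarith
  have h6 : Q ^ 2 ≤ (n + 1) ^ 4 * Sa ^ 2 := by
    calc Q ^ 2 ≤ ((n + 1) ^ 2 * Sa) ^ 2 := by gcongr
      _ = _ := by ring
  refine le_of_mul_le_mul_left ?_ hP0
  rw [h1]
  refine h6.trans ?_
  calc _ ≤ (n + 1 : ℝ) ^ 4 * (P * ∑ U ∈ dyckPaths n, ∏ j ∈ U, w j) := by gcongr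
    _ = _ := by ring

section Curve

variable {β : ℝ}

lemma one_add_exp_sub_exp_pos (hβ : 0 < β) {x : ℝ} (hx : x ≤ 1) :
    1 ≤ 1 + Real.exp β - Real.exp (β * x) := by
  have : Real.exp (β * x) ≤ Real.exp β := Real.exp_le_exp.2 (by nlinarith)
  linarith

lemma exp_add_exp_f231 (hβ : 0 < β) {x : ℝ} (hx : x ≤ 1) :
    Real.exp (β * x) + Real.exp (β * (1 - f231 β x)) = 1 + Real.exp β := by
  have h := one_add_exp_sub_exp_pos hβ hx
  have : β * (1 - f231 β x) = Real.log (1 + Real.exp β - Real.exp (β * x)) := by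
    rw [f231]; field_simp; ring
  rw [this, Real.exp_log (by linarith)]
  ring

lemma f231_eq_of_exp_add_exp (hβ : 0 < β) {x y : ℝ}
    (h : Real.exp (β * x) + Real.exp (β * (1 - y)) = 1 + Real.exp β) : f231 β x = y := by
  have : 1 + Real.exp β - Real.exp (β * x) = Real.exp (β * (1 - y)) := by linarith
  rw [f231, this, Real.log_exp]
  field_simp
  ring

lemma f231_zero (hβ : 0 < β) : f231 β 0 = 0 :=
  f231_eq_of_exp_add_exp hβ (by simp)

lemma f231_one (hβ : 0 < β) : f231 β 1 = 1 :=
  f231_eq_of_exp_add_exp hβ (by simp [add_comm])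

lemma f231_strictMonoOn (hβ : 0 < β) : StrictMonoOn (f231 β) (Iic 1) := by
  intro x hx y hy hxy
  have h1 := exp_add_exp_f231 hβ (mem_Iic.1 hx)
  have h2 := exp_add_exp_f231 hβ (mem_Iic.1 hy)
  have h3 : Real.exp (β * x) < Real.exp (β * y) := Real.exp_lt_exp.2 (by nlinarith)
  have h4 : Real.exp (β * (1 - f231 β y)) < Real.exp (β * (1 - f231 β x)) := by linarith
  have := Real.exp_lt_exp.1 h4
  nlinarith

lemma f231_mem_Icc (hβ : 0 < β) {x : ℝ} (hx : x ∈ Icc (0 : ℝ) 1) : f231 β x ∈ Icc (0 : ℝ) 1 := by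
  have h := (f231_strictMonoOn hβ).monotoneOn
  constructor
  · rw [← f231_zero hβ]
    exact h (by simp) hx.2 hx.1
  · rw [← f231_one hβ]
    exact h hx.2 (by simp) hx.2

/-- The curve is symmetric with respect to the antidiagonal. -/
lemma f231_one_sub_f231 (hβ : 0 < β) {x : ℝ} (hx : x ≤ 1) : f231 β (1 - f231 β x) = 1 - x := by
  apply f231_eq_of_exp_add_exp hβ
  rw [sub_sub_cancel, add_comm]
  exact exp_add_exp_f231 hβ hx

lemma hasDerivAt_f231 (hβ : 0 < β) {x : ℝ} (hx : x ≤ 1) :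
    HasDerivAt (f231 β) (Real.exp (β * x) / (1 + Real.exp β - Real.exp (β * x))) x := by
  have h := one_add_exp_sub_exp_pos hβ hx
  have h1 : HasDerivAt (fun x => 1 + Real.exp β - Real.exp (β * x))
      (-(Real.exp (β * x) * β)) x := by
    have := ((hasDerivAt_id x).const_mul β).exp
    simp only [id, mul_one] at this
    exact this.const_sub _
  have h2 := (((h1.log (by linarith)).const_mul (1 / β)).const_sub 1)
  have e : -(1 / β * (-(Real.exp (β * x) * β) / (1 + Real.exp β - Real.exp (β * x)))) =
      Real.exp (β * x) / (1 + Real.exp β - Real.exp (β * x)) := by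
    field_simp
  rw [← e]
  exact h2

lemma deriv_f231 (hβ : 0 < β) {x : ℝ} (hx : x ≤ 1) :
    deriv (f231 β) x = Real.exp (β * x) / (1 + Real.exp β - Real.exp (β * x)) :=
  (hasDerivAt_f231 hβ hx).deriv

lemma deriv_f231_mono (hβ : 0 < β) {x y : ℝ} (hxy : x ≤ y) (hy : y ≤ 1) :
    deriv (f231 β) x ≤ deriv (f231 β) y := by
  rw [deriv_f231 hβ hy, deriv_f231 hβ (hxy.trans hy)]
  have h1 := one_add_exp_sub_exp_pos hβ hy
  have h2 : Real.exp (β * x) ≤ Real.exp (β * y) := Real.exp_le_exp.2 (by nlinarith)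
  have := Real.exp_pos (β * x)
  apply div_le_div₀ <;> linarith

lemma deriv_f231_nonneg (hβ : 0 < β) {x : ℝ} (hx : x ≤ 1) : 0 ≤ deriv (f231 β) x := by
  rw [deriv_f231 hβ hx]
  have h1 := one_add_exp_sub_exp_pos hβ hx
  have := Real.exp_pos (β * x)
  apply div_nonneg <;> linarith

lemma deriv_f231_le (hβ : 0 < β) {x : ℝ} (hx : x ≤ 1) : deriv (f231 β) x ≤ Real.exp β := by
  rw [deriv_f231 hβ hx]
  have h1 := one_add_exp_sub_exp_pos hβ hx
  have := Real.exp_pos (β * x)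
  refine (div_le_self this.le h1).trans (Real.exp_le_exp.2 (by nlinarith))

lemma continuousOn_f231 (hβ : 0 < β) : ContinuousOn (f231 β) (Iic 1) := fun _ hx =>
  (hasDerivAt_f231 hβ hx).continuousAt.continuousWithinAt

lemma abs_f231_sub_le (hβ : 0 < β) {x y : ℝ} (hx : x ≤ 1) (hy : y ≤ 1) :
    |f231 β x - f231 β y| ≤ Real.exp β * |x - y| := by
  have := Convex.norm_image_sub_le_of_norm_deriv_le (f := f231 β) (C := Real.exp β) (s := Iic 1)
    (fun z hz => (hasDerivAt_f231 hβ hz).differentiableAt)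
    (fun z hz => by
      rw [Real.norm_eq_abs, abs_of_nonneg (deriv_f231_nonneg hβ hz)]
      exact deriv_f231_le hβ hz) (convex_Iic 1) (mem_Iic.2 hy) (mem_Iic.2 hx)
  simpa [Real.norm_eq_abs] using this

lemma convexOn_f231 (hβ : 0 < β) : ConvexOn ℝ (Iic 1) (f231 β) := by
  refine MonotoneOn.convexOn_of_deriv (convex_Iic 1) (continuousOn_f231 hβ)
    (fun x hx => ?_) fun x hx y hy hxy => ?_
  · rw [interior_Iic] at hx
    exact (hasDerivAt_f231 hβ (le_of_lt hx)).differentiableAt.differentiableWithinAt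
  · rw [interior_Iic] at hy
    exact deriv_f231_mono hβ hxy (le_of_lt hy)

/-- Concavity of `z ↦ z - f231 β z`, in the form of quasiconcavity. -/
lemma min_sub_f231_le (hβ : 0 < β) {x y z : ℝ} (hxz : x ≤ z) (hzy : z ≤ y) (hy : y ≤ 1) :
    min (x - f231 β x) (y - f231 β y) ≤ z - f231 β z := by
  have hc : ConcaveOn ℝ (Iic 1) (fun z => z - f231 β z) :=
    (concaveOn_id (convex_Iic 1)).sub (convexOn_f231 hβ)
  have hz : z ∈ segment ℝ x y := by rw [segment_eq_Icc (hxz.trans hzy)]; exact ⟨hxz, hzy⟩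
  exact hc.min_le_of_mem_segment (mem_Iic.2 ((hxz.trans hzy).trans hy)) (mem_Iic.2 hy) hz

end Curve

section MeanCount

/-- The logistic function. -/
def logistic (z : ℝ) : ℝ := Real.exp z / (1 + Real.exp z)

lemma logistic_mono {a b : ℝ} (h : a ≤ b) : logistic a ≤ logistic b := by
  have ha := Real.exp_pos a
  have hb := Real.exp_pos b
  have := Real.exp_le_exp.2 h
  rw [logistic, logistic, div_le_div_iff₀ (by positivity) (by positivity)]
  nlinarith

lemma logistic_nonneg (a : ℝ) : 0 ≤ logistic a := by
  have ha := Real.exp_pos a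
  rw [logistic]; positivity

lemma logistic_le_one (a : ℝ) : logistic a ≤ 1 := by
  have ha := Real.exp_pos a
  rw [logistic, div_le_one (by positivity)]
  linarith

lemma log_one_add_exp_ge (a b : ℝ) :
    Real.log (1 + Real.exp a) + logistic a * (b - a) ≤ Real.log (1 + Real.exp b) := by
  have ha := Real.exp_pos a
  have hb := Real.exp_pos b
  rw [Real.le_log_iff_exp_le (by positivity), Real.exp_add, Real.exp_log (by positivity)]
  have h := convexOn_exp.2 (mem_univ 0) (mem_univ (b - a))
    (sub_nonneg.2 (logistic_le_one a)) (logistic_nonneg a) (by ring)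
  simp only [smul_eq_mul, mul_zero, zero_add, Real.exp_zero, mul_one] at h
  calc _ ≤ (1 + Real.exp a) * (1 - logistic a + logistic a * Real.exp (b - a)) := by gcongr
    _ = _ := by
      rw [Real.exp_sub, logistic]
      field_simp
      ring

lemma abs_meanCount_odds_sub_le {β : ℝ} (hβ : 0 < β) {n : ℕ} (hn : 1 ≤ n) (t : ℕ) :
    |meanCount (odds β n) t - n * (1 / β * (Real.log (1 + Real.exp β) -
      Real.log (1 + Real.exp (β * (1 - t / n)))))| ≤ 1 := by
  have hn' : (0 : ℝ) < n := by exact_mod_cast hn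
  set z : ℕ → ℝ := fun j => β * (1 - j / n) with hz
  have hz1 : ∀ j, z j - z (j + 1) = β / n := by
    intro j; simp only [hz]; push_cast; field_simp; ring
  have key : ∀ j : ℕ, |logistic (β / n * (n - 1 / 2 - j)) - n / β *
      (Real.log (1 + Real.exp (z j)) - Real.log (1 + Real.exp (z (j + 1))))| ≤
        logistic (z j) - logistic (z (j + 1)) := by
    intro j
    have h0 := hz1 j
    have hb : 0 < β / n := by positivity
    have e : β / n * (n - 1 / 2 - j) = z j - β / n / 2 := by simp only [hz]; field_simp; ring
    have m1 : logistic (β / n * (n - 1 / 2 - j)) ≤ logistic (z j) := logistic_mono (by linarith)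
    have m2 : logistic (z (j + 1)) ≤ logistic (β / n * (n - 1 / 2 - j)) :=
      logistic_mono (by linarith)
    have l1 := log_one_add_exp_ge (z j) (z (j + 1))
    have l2 := log_one_add_exp_ge (z (j + 1)) (z j)
    rw [show z (j + 1) - z j = -(β / n) by linarith] at l1
    rw [h0] at l2
    set D := Real.log (1 + Real.exp (z j)) - Real.log (1 + Real.exp (z (j + 1)))
    have d1 : n / β * D ≤ logistic (z j) := by
      rw [div_mul_eq_mul_div, div_le_iff₀ hβ]
      have : D ≤ logistic (z j) * (β / n) := by linarith
      calc n * D ≤ n * (logistic (z j) * (β / n)) := by gcongr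
        _ = _ := by field_simp
    have d2 : logistic (z (j + 1)) ≤ n / β * D := by
      rw [div_mul_eq_mul_div, le_div_iff₀ hβ]
      have : logistic (z (j + 1)) * (β / n) ≤ D := by linarith
      calc _ = n * (logistic (z (j + 1)) * (β / n)) := by field_simp
        _ ≤ n * D := by gcongr
    rw [abs_le]; constructor <;> linarith
  have tel : (n : ℝ) * (1 / β * (Real.log (1 + Real.exp β) -
      Real.log (1 + Real.exp (β * (1 - t / n))))) = ∑ j ∈ Finset.range t, n / β *
      (Real.log (1 + Real.exp (z j)) - Real.log (1 + Real.exp (z (j + 1)))) := by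
    rw [← Finset.mul_sum, Finset.sum_range_sub']
    simp [hz]
    field_simp
  rw [tel, meanCount, ← Finset.sum_sub_distrib]
  refine (Finset.abs_sum_le_sum_abs _ _).trans ((Finset.sum_le_sum fun j _ => key j).trans ?_)
  rw [Finset.sum_range_sub']
  linarith [logistic_le_one (z 0), logistic_nonneg (z t)]

/-- The parametrisation of the curve by `x + y`. -/
lemma f231_log_sub_log {β : ℝ} (hβ : 0 < β) {s x : ℝ}
    (hx : x = 1 / β * (Real.log (1 + Real.exp β) - Real.log (1 + Real.exp (β * (1 - s))))) :
    f231 β x = s - x := by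
  have h1 : β * x = Real.log (1 + Real.exp β) - Real.log (1 + Real.exp (β * (1 - s))) := by
    rw [hx]; field_simp
  have p1 := Real.exp_pos β
  have p2 := Real.exp_pos (β * (1 - s))
  have h2 : Real.exp (β * x) = (1 + Real.exp β) / (1 + Real.exp (β * (1 - s))) := by
    rw [h1, Real.exp_sub, Real.exp_log (by positivity), Real.exp_log (by positivity)]
  apply f231_eq_of_exp_add_exp hβ
  rw [show β * (1 - (s - x)) = β * (1 - s) + β * x by ring, Real.exp_add, h2]
  field_simp

lemma abs_tailMin_div_sub_f231_le {β : ℝ} (hβ : 0 < β) {n : ℕ} (hn : 1 ≤ n)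
    (σ : Equiv.Perm (Fin n)) {k : ℕ} (hk : k ≤ n) {δ : ℝ}
    (h : |(k : ℝ) - meanCount (odds β n) (k + tailMin σ k)| ≤ δ * n) :
    |(tailMin σ k : ℝ) / n - f231 β (k / n)| ≤ (1 + Real.exp β) * (δ + 1 / n) := by
  have hn' : (0 : ℝ) < n := by exact_mod_cast hn
  have h1 := abs_meanCount_odds_sub_le hβ hn (k + tailMin σ k)
  set s : ℝ := ((k + tailMin σ k : ℕ) : ℝ) / n with hs
  obtain ⟨x, hx⟩ : ∃ x, x = 1 / β * (Real.log (1 + Real.exp β) -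
    Real.log (1 + Real.exp (β * (1 - s)))) := ⟨_, rfl⟩
  rw [← hx] at h1
  have hf := f231_log_sub_log hβ hx
  have hx1 : x ≤ 1 := by
    have hs2 : s ≤ 2 := by
      rw [hs, div_le_iff₀ hn']
      have : k + tailMin σ k ≤ 2 * n := by have := tailMin_le_self σ hk; omega
      exact_mod_cast this
    have e : 1 + Real.exp β = Real.exp β * (1 + Real.exp (-β)) := by
      rw [mul_add, ← Real.exp_add]; simp [add_comm]
    have p1 := Real.exp_pos β
    have p2 := Real.exp_pos (-β)
    have : Real.log (1 + Real.exp (-β)) ≤ Real.log (1 + Real.exp (β * (1 - s))) := by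
      apply Real.log_le_log (by positivity)
      have : Real.exp (-β) ≤ Real.exp (β * (1 - s)) := Real.exp_le_exp.2 (by nlinarith)
      linarith
    rw [hx, e, Real.log_mul (by positivity) (by positivity), Real.log_exp, one_div_mul_eq_div,
      div_le_one hβ]
    linarith
  have h2 : |(k : ℝ) / n - x| ≤ δ + 1 / n := by
    have : |(k : ℝ) - n * x| ≤ δ * n + 1 := by
      have := abs_sub_le (k : ℝ) (meanCount (odds β n) (k + tailMin σ k)) (n * x)
      linarith
    have e : (k : ℝ) / n - x = (k - n * x) / n := by field_simp
    rw [e, abs_div, abs_of_pos hn', div_le_iff₀ hn']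
    calc _ ≤ δ * n + 1 := this
      _ = _ := by field_simp
  have hk1 : (k : ℝ) / n ≤ 1 := by
    rw [div_le_one hn']; exact_mod_cast hk
  have h3 := abs_f231_sub_le hβ hx1 hk1
  have e : (tailMin σ k : ℝ) / n - f231 β (k / n) =
      (f231 β x - f231 β (k / n)) + (x - k / n) := by
    rw [hf, hs]; push_cast; field_simp; ring
  rw [e]
  refine (abs_add_le _ _).trans ?_
  rw [abs_sub_comm] at h2
  have := mul_le_mul_of_nonneg_left h2 (Real.exp_pos β).le
  linarith

end MeanCount

/-- The `231`-avoiding permutations. -/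
def avoiders (n : ℕ) : Finset (Equiv.Perm (Fin n)) :=
  Finset.univ.filter (fun σ : Equiv.Perm (Fin n) => Avoids231 σ)

lemma sum_le_sum_sum_filter {ι κ : Type*} {I s : Finset ι} {T : Finset κ} {p : κ → ι → Prop}
    [∀ t, DecidablePred (p t)] {f : ι → ℝ} (hf : ∀ i, 0 ≤ f i)
    (hI : ∀ i ∈ I, i ∈ s ∧ ∃ t ∈ T, p t i) :
    ∑ i ∈ I, f i ≤ ∑ t ∈ T, ∑ i ∈ s.filter (p t), f i := by
  simp only [Finset.sum_filter]
  rw [Finset.sum_comm]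
  have h0 : ∀ i t, 0 ≤ if p t i then f i else 0 := fun i t => by
    split_ifs
    · exact hf i
    · exact le_rfl
  refine (Finset.sum_le_sum fun i hi => ?_).trans (Finset.sum_le_sum_of_subset_of_nonneg
    (fun i hi => (hI i hi).1) fun i _ _ => Finset.sum_nonneg fun t _ => h0 i t)
  obtain ⟨t, ht, hp⟩ := (hI i hi).2
  refine le_trans ?_ (Finset.single_le_sum (fun t _ => h0 i t) ht)
  rw [if_pos hp]

/-- The positions of the up-steps deviate from their mean by more than `δ * n`. -/
def HasDeviation (β δ : ℝ) {n : ℕ} (σ : Equiv.Perm (Fin n)) : Prop :=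
  ∃ k ≤ n, δ * n < |(k : ℝ) - meanCount (odds β n) (k + tailMin σ k)|

lemma Z231_pos (β : ℝ) (n : ℕ) : 0 < Z231 β n := by
  refine Finset.sum_pos (fun σ _ => Real.exp_pos _) ⟨1, ?_⟩
  simp only [Finset.mem_filter, Finset.mem_univ, true_and]
  rintro ⟨i, j, k, hij, hjk, hki, -⟩
  simp only [Equiv.Perm.coe_one, id] at hki
  exact absurd (hij.trans hjk) (not_lt.2 hki.le)

lemma exp_half_mul_sum (β : ℝ) {n : ℕ} (hn : 1 ≤ n) (p : Equiv.Perm (Fin n) → Prop) :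
    Real.exp (β / 2) * ∑ σ ∈ (avoiders n).filter p, Real.exp (β / n * invCount σ) =
      ∑ U ∈ ((avoiders n).filter p).image upSteps, ∏ j ∈ U, odds β n j := by
  have hσ : ∀ σ ∈ (avoiders n).filter p, Avoids231 σ := fun σ h =>
    (Finset.mem_filter.1 (Finset.mem_filter.1 h).1).2
  rw [Finset.sum_image (upSteps_injOn.mono fun σ h => hσ σ h), Finset.mul_sum]
  exact Finset.sum_congr rfl fun σ h => (prod_odds_upSteps hn β (hσ σ h)).symm

lemma sum_dyckPaths_le (β : ℝ) {n : ℕ} (hn : 1 ≤ n) :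
    ∑ U ∈ dyckPaths n, ∏ j ∈ U, odds β n j ≤ Real.exp (β / 2) * Z231 β n := by
  have h := exp_half_mul_sum β hn (fun _ => True)
  rw [Finset.filter_true] at h
  rw [Z231, ← avoiders, h]
  refine Finset.sum_le_sum_of_subset_of_nonneg (fun U hU => ?_) fun U _ _ =>
    Finset.prod_nonneg fun j _ => (odds_pos β n j).le
  simp only [dyckPaths, Finset.mem_filter, Finset.mem_powerset] at hU
  obtain ⟨σ, hσ, rfl⟩ := exists_upSteps_eq hU.1 hU.2.1 hU.2.2
  exact Finset.mem_image_of_mem _ (by simpa [avoiders] using hσ)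

lemma one_le_odds {β : ℝ} (hβ : 0 ≤ β) {n j : ℕ} (hj : j < n) : 1 ≤ odds β n j := by
  have : (j : ℝ) + 1 ≤ n := by exact_mod_cast hj
  rw [odds]
  exact Real.one_le_exp (mul_nonneg (by positivity) (by linarith))

lemma odds_mul_odds_reflect (β : ℝ) {n j : ℕ} (hj : j < n) :
    odds β n j * odds β n (2 * n - 1 - j) = 1 := by
  rw [odds, odds, ← Real.exp_add, Real.exp_eq_one_iff, Nat.cast_sub (by omega),
    Nat.cast_sub (by omega)]
  push_cast
  ring

lemma sum_hasDeviation_le {β δ : ℝ} (hβ : 0 ≤ β) (hδ0 : 0 ≤ δ) (hδ1 : δ ≤ 1) {n : ℕ}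
    (hn : 1 ≤ n) :
    ∑ σ ∈ (avoiders n).filter (HasDeviation β δ), Real.exp (β / n * invCount σ) ≤
      (2 * n + 1) * 2 * (n + 1) ^ 4 * Real.exp (-(δ ^ 2 / 8 * n)) * Z231 β n := by
  have hpos : ∀ U : Finset ℕ, 0 ≤ ∏ j ∈ U, odds β n j := fun U =>
    Finset.prod_nonneg fun j _ => (odds_pos β n j).le
  refine le_of_mul_le_mul_left ?_ (Real.exp_pos (β / 2))
  rw [exp_half_mul_sum β hn]
  calc _ ≤ ∑ t ∈ Finset.range (2 * n + 1), ∑ U ∈ (Finset.range (2 * n)).powerset.filter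
          (fun U => δ * n < |((U.filter (· < t)).card : ℝ) - meanCount (odds β n) t|),
          ∏ j ∈ U, odds β n j := by
        refine sum_le_sum_sum_filter hpos fun U hU => ?_
        obtain ⟨σ, hσ, rfl⟩ := Finset.mem_image.1 hU
        obtain ⟨k, hk, h⟩ := (Finset.mem_filter.1 hσ).2
        refine ⟨Finset.mem_powerset.2 (upSteps_subset σ), k + tailMin σ k, ?_, ?_⟩
        · have := tailMin_le_self σ hk
          simp; omega
        · rwa [card_upSteps_filter σ hk]
    _ ≤ ∑ t ∈ Finset.range (2 * n + 1), 2 * (∏ j ∈ Finset.range (2 * n), (1 + odds β n j)) *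
          Real.exp (-(δ ^ 2 / 8 * n)) := by
        refine Finset.sum_le_sum fun t ht => ?_
        have ht : t ≤ 2 * n := by have := Finset.mem_range.1 ht; omega
        have := sum_deviation_le (odds_pos β n) ht (s := δ / 4) (a := δ * n) (by positivity)
          (by linarith)
        have e : (δ / 4) ^ 2 * ((2 * n : ℕ) : ℝ) - δ / 4 * (δ * n) = -(δ ^ 2 / 8 * n) := by
          push_cast
          ring
        rwa [e] at this
    _ = (2 * n + 1) * 2 * Real.exp (-(δ ^ 2 / 8 * n)) *
          ∏ j ∈ Finset.range (2 * n), (1 + odds β n j) := by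
        simp only [Finset.sum_const, Finset.card_range, nsmul_eq_mul]
        push_cast
        ring
    _ ≤ (2 * n + 1) * 2 * Real.exp (-(δ ^ 2 / 8 * n)) *
          ((n + 1) ^ 4 * (Real.exp (β / 2) * Z231 β n)) := by
        gcongr
        refine (prod_le_sum_dyckPaths (odds_pos β n) (fun j hj => one_le_odds hβ hj)
          (fun j hj => odds_mul_odds_reflect β hj)).trans ?_
        gcongr
        exact sum_dyckPaths_le β hn
    _ = _ := by ring

lemma tendsto_poly_mul_exp_neg {c : ℝ} (hc : 0 < c) :
    Tendsto (fun n : ℕ => (2 * n + 1) * 2 * (n + 1) ^ 4 * Real.exp (-(c * n))) atTop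
      (nhds (0 : ℝ)) := by
  have h1 : Tendsto (fun n : ℕ => c * ((n : ℝ) + 1)) atTop atTop :=
    (tendsto_natCast_atTop_atTop.atTop_add tendsto_const_nhds).const_mul_atTop hc
  have h2 := ((Real.tendsto_pow_mul_exp_neg_atTop_nhds_zero 5).comp h1).const_mul
    (4 * Real.exp c / c ^ 5)
  rw [mul_zero] at h2
  refine squeeze_zero (fun n => by positivity) (fun n => ?_) h2
  have e : 4 * Real.exp c / c ^ 5 * ((c * ((n : ℝ) + 1)) ^ 5 * Real.exp (-(c * ((n : ℝ) + 1)))) =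
      (2 * (n + 1)) * 2 * (n + 1) ^ 4 * Real.exp (-(c * n)) := by
    rw [show -(c * ((n : ℝ) + 1)) = -(c * n) + -c by ring, Real.exp_add, Real.exp_neg c]
    field_simp
    ring
  simp only [Function.comp]
  rw [e]
  gcongr
  linarith

lemma tendsto_sum_hasDeviation {β δ : ℝ} (hβ : 0 ≤ β) (hδ0 : 0 < δ) :
    Tendsto (fun n : ℕ => (∑ σ ∈ (avoiders n).filter (HasDeviation β δ),
      Real.exp (β / n * invCount σ)) / Z231 β n) atTop (nhds 0) := by
  have hm : 0 < min δ 1 := lt_min hδ0 one_pos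
  refine squeeze_zero' (Eventually.of_forall fun n => ?_) ?_
    (tendsto_poly_mul_exp_neg (c := (min δ 1) ^ 2 / 8) (by positivity))
  · exact div_nonneg (Finset.sum_nonneg fun σ _ => (Real.exp_pos _).le) (Z231_pos β n).le
  · filter_upwards [eventually_ge_atTop 1] with n hn
    rw [div_le_iff₀ (Z231_pos β n)]
    refine le_trans ?_ (sum_hasDeviation_le hβ hm.le (min_le_right _ _) hn)
    refine Finset.sum_le_sum_of_subset_of_nonneg (fun σ hσ => ?_) fun σ _ _ => (Real.exp_pos _).le
    simp only [Finset.mem_filter] at hσ ⊢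
    obtain ⟨h, k, hk, hd⟩ := hσ
    refine ⟨h, k, hk, lt_of_le_of_lt ?_ hd⟩
    gcongr
    exact min_le_left _ _

lemma invCount_le_of_not_hasDeviation {δ : ℝ} {n : ℕ} {σ : Equiv.Perm (Fin n)}
    (hσ : Avoids231 σ) (h : ¬ HasDeviation 0 δ σ) : (invCount σ : ℝ) ≤ 2 * δ * n ^ 2 := by
  have h1 : (invCount σ : ℝ) + ∑ i : Fin n, (tailMin σ i : ℝ) = ∑ i : Fin n, ((i : ℕ) : ℝ) := by
    exact_mod_cast invCount_add_sum_tailMin hσ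
  have h2 : ∀ i : Fin n, ((i : ℕ) : ℝ) - tailMin σ i ≤ 2 * δ * n := by
    intro i
    by_contra hc
    refine h ⟨i, i.2.le, lt_of_lt_of_le ?_ (le_abs_self _)⟩
    have : meanCount (odds 0 n) (i + tailMin σ i) = ((i : ℕ) + tailMin σ i : ℝ) / 2 := by
      simp [meanCount, odds]
      ring
    rw [this]
    linarith
  have h3 : ∑ i : Fin n, (((i : ℕ) : ℝ) - tailMin σ i) ≤ ∑ _i : Fin n, 2 * δ * n :=
    Finset.sum_le_sum fun i _ => h2 i
  rw [Finset.sum_sub_distrib] at h3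
  simp only [Finset.sum_const, Finset.card_univ, Fintype.card_fin, nsmul_eq_mul] at h3
  linarith

lemma tendsto_sum_invCount_gt {β δ : ℝ} (hβ : β ≤ 0) (hδ : 0 < δ) :
    Tendsto (fun n : ℕ => (∑ σ ∈ (avoiders n).filter (fun σ => δ * n ^ 2 < invCount σ),
      Real.exp (β / n * invCount σ)) / Z231 β n) atTop (nhds 0) := by
  have h0 := tendsto_sum_hasDeviation (le_refl (0 : ℝ)) (half_pos hδ)
  have h1 := h0.const_mul 2
  rw [mul_zero] at h1
  refine squeeze_zero' (Eventually.of_forall fun n => ?_) ?_ h1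
  · exact div_nonneg (Finset.sum_nonneg fun σ _ => (Real.exp_pos _).le) (Z231_pos β n).le
  · filter_upwards [eventually_ge_atTop 1, h0.eventually_le_const (half_pos one_pos)] with n hn hb
    have hn' : (0 : ℝ) < n := by exact_mod_cast hn
    have hZ : Z231 0 n = (avoiders n).card := by simp [Z231, avoiders]
    have hZ0 := Z231_pos 0 n
    simp only [zero_div, zero_mul, Real.exp_zero, Finset.sum_const, nsmul_eq_mul, mul_one] at hb ⊢
    set D := ((avoiders n).filter (HasDeviation 0 (δ / 2))).card
    set B := (avoiders n).filter (fun σ => δ * n ^ 2 < invCount σ) with hB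
    set C := (avoiders n).filter (fun σ => ¬ δ * n ^ 2 < invCount σ) with hC
    have hBD : (B.card : ℝ) ≤ D := by
      refine Nat.cast_le.2 (Finset.card_le_card fun σ hσ => ?_)
      simp only [hB, Finset.mem_filter] at hσ ⊢
      refine ⟨hσ.1, ?_⟩
      by_contra hc
      have := invCount_le_of_not_hasDeviation (by simpa [avoiders] using hσ.1) hc
      linarith [hσ.2]
    have hBC : (B.card : ℝ) + C.card = (avoiders n).card := by
      exact_mod_cast Finset.card_filter_add_card_filter_not (s := avoiders n) _
    have hsB : ∑ σ ∈ B, Real.exp (β / n * invCount σ) ≤ B.card * Real.exp (β * δ * n) := by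
      rw [← nsmul_eq_mul]
      refine Finset.sum_le_card_nsmul _ _ _ fun σ hσ => Real.exp_le_exp.2 ?_
      have h : δ * n ^ 2 ≤ invCount σ := (Finset.mem_filter.1 hσ).2.le
      calc β / n * invCount σ ≤ β / n * (δ * n ^ 2) :=
            mul_le_mul_of_nonpos_left h (div_nonpos_of_nonpos_of_nonneg hβ hn'.le)
        _ = _ := by field_simp
    have hsC : C.card * Real.exp (β * δ * n) ≤ Z231 β n := by
      rw [← nsmul_eq_mul]
      refine (Finset.card_nsmul_le_sum C (fun σ => Real.exp (β / n * invCount σ)) _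
        fun σ hσ => Real.exp_le_exp.2 ?_).trans ?_
      · have h : (invCount σ : ℝ) ≤ δ * n ^ 2 := not_lt.1 (Finset.mem_filter.1 hσ).2
        calc β * δ * n = β / n * (δ * n ^ 2) := by field_simp
          _ ≤ _ := mul_le_mul_of_nonpos_left h (div_nonpos_of_nonpos_of_nonneg hβ hn'.le)
      · exact Finset.sum_le_sum_of_subset_of_nonneg (Finset.filter_subset _ _)
          fun σ _ _ => (Real.exp_pos _).le
    rw [div_le_iff₀ (Z231_pos β n)]
    rw [div_le_iff₀ hZ0, hZ] at hb
    refine hsB.trans (le_trans ?_ (mul_le_mul_of_nonneg_left hsC (by positivity)))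
    rw [hZ] at hZ0 ⊢
    rw [← mul_assoc]
    gcongr
    rw [← mul_div_assoc, div_mul_eq_mul_div, le_div_iff₀ hZ0]
    have hCZ : ((avoiders n).card : ℝ) ≤ 2 * C.card := by linarith
    calc (B.card : ℝ) * (avoiders n).card ≤ D * (2 * C.card) := by gcongr
      _ = _ := by ring

section Law

variable {Ω : Type*} [MeasureSpace Ω]

lemma volume_le_of_law {β : ℝ} {τ : (n : ℕ) → Ω → Equiv.Perm (Fin n)}
    (hlaw : ∀ (n : ℕ), 1 ≤ n → ∀ σ : Equiv.Perm (Fin n),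
      volume {ω | τ n ω = σ} =
        ENNReal.ofReal
          (if Avoids231 σ then Real.exp (β / n * invCount σ) / Z231 β n else 0))
    {n : ℕ} (hn : 1 ≤ n) (p : Equiv.Perm (Fin n) → Prop) :
    volume {ω | ¬ Avoids231 (τ n ω) ∨ p (τ n ω)} ≤
      ENNReal.ofReal ((∑ σ ∈ (avoiders n).filter p, Real.exp (β / n * invCount σ)) /
        Z231 β n) := by
  have h1 : {ω | ¬ Avoids231 (τ n ω) ∨ p (τ n ω)} ⊆
      ⋃ σ ∈ Finset.univ.filter (fun σ : Equiv.Perm (Fin n) => ¬ Avoids231 σ ∨ p σ),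
        {ω | τ n ω = σ} := by
    intro ω hω
    simp only [Finset.mem_filter, Finset.mem_univ, true_and, mem_iUnion, mem_ofPred_eq]
    exact ⟨τ n ω, hω, rfl⟩
  refine (measure_mono h1).trans ((measure_biUnion_finset_le _ _).trans ?_)
  have hZ := Z231_pos β n
  rw [Finset.sum_congr rfl fun σ _ => hlaw n hn σ, ← ENNReal.ofReal_sum_of_nonneg]
  · refine ENNReal.ofReal_le_ofReal (le_of_eq ?_)
    rw [Finset.sum_div, ← Finset.sum_filter]
    refine Finset.sum_congr ?_ fun _ _ => rfl
    ext σ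
    simp only [avoiders, Finset.mem_filter, Finset.mem_univ, true_and]
    tauto
  · intro σ _
    split_ifs <;> positivity

lemma tendsto_volume_of_law {β : ℝ} {τ : (n : ℕ) → Ω → Equiv.Perm (Fin n)}
    (hlaw : ∀ (n : ℕ), 1 ≤ n → ∀ σ : Equiv.Perm (Fin n),
      volume {ω | τ n ω = σ} =
        ENNReal.ofReal
          (if Avoids231 σ then Real.exp (β / n * invCount σ) / Z231 β n else 0))
    (p : (n : ℕ) → Equiv.Perm (Fin n) → Prop)
    (h : Tendsto (fun n : ℕ => (∑ σ ∈ (avoiders n).filter (p n),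
      Real.exp (β / n * invCount σ)) / Z231 β n) atTop (nhds 0))
    (S : ℕ → Set Ω)
    (hS : ∀ᶠ n in atTop, S n ⊆ {ω | ¬ Avoids231 (τ n ω) ∨ p n (τ n ω)}) :
    Tendsto (fun n => volume (S n)) atTop (nhds 0) := by
  have h' := ENNReal.tendsto_ofReal h
  rw [ENNReal.ofReal_zero] at h'
  refine tendsto_of_tendsto_of_tendsto_of_le_of_le' tendsto_const_nhds h'
    (Eventually.of_forall fun n => zero_le) ?_
  filter_upwards [hS, eventually_ge_atTop 1] with n hn hn1
  exact (measure_mono hn).trans (volume_le_of_law hlaw hn1 (p n))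

end Law

section WeakConvergence

lemma Iic_prod_inter (x y : ℝ) :
    Iic x ×ˢ Iic y ∩ Icc (0 : ℝ) 1 ×ˢ Icc (0 : ℝ) 1 =
      Iic (min x 1) ×ˢ Iic (min y 1) ∩ Icc (0 : ℝ) 1 ×ˢ Icc (0 : ℝ) 1 := by
  ext ⟨a, b⟩
  simp only [mem_inter_iff, mem_prod, mem_Iic, mem_Icc, le_min_iff]
  tauto

lemma measureReal_inter_of_eq_one {μ : Measure (ℝ × ℝ)} [IsProbabilityMeasure μ]
    (hμ : μ (Icc (0 : ℝ) 1 ×ˢ Icc (0 : ℝ) 1) = 1) (A : Set (ℝ × ℝ)) :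
    μ.real (A ∩ Icc (0 : ℝ) 1 ×ˢ Icc (0 : ℝ) 1) = μ.real A := by
  refine measureReal_congr ?_
  have : (Icc (0 : ℝ) 1 ×ˢ Icc (0 : ℝ) 1) =ᵐ[μ] (univ : Set (ℝ × ℝ)) := by
    rw [ae_eq_univ, prob_compl_eq_zero_iff (measurableSet_Icc.prod measurableSet_Icc)]
    exact hμ
  simpa using (ae_eq_refl A).inter this

lemma measureReal_Ioc_prod_Ioc (μ : Measure (ℝ × ℝ)) [IsFiniteMeasure μ] {a b c d : ℝ}
    (hab : a ≤ b) (hcd : c ≤ d) :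
    μ.real (Ioc a b ×ˢ Ioc c d) =
      μ.real (Iic b ×ˢ Iic d) - μ.real (Iic a ×ˢ Iic d) -
        (μ.real (Iic b ×ˢ Iic c) - μ.real (Iic a ×ˢ Iic c)) := by
  have h1 : ∀ e, μ.real (Ioc a b ×ˢ Iic e) = μ.real (Iic b ×ˢ Iic e) - μ.real (Iic a ×ˢ Iic e) := by
    intro e
    rw [← measureReal_sdiff (prod_mono (Iic_subset_Iic.2 hab) le_rfl)
      (measurableSet_Iic.prod measurableSet_Iic)]
    congr 1
    ext ⟨p, q⟩
    simp only [mem_prod, mem_Ioc, mem_Iic, Set.mem_sdiff]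
    constructor
    · rintro ⟨⟨h1, h2⟩, h3⟩
      exact ⟨⟨h2, h3⟩, fun h => absurd h.1 (not_le.2 h1)⟩
    · rintro ⟨⟨h1, h2⟩, h3⟩
      exact ⟨⟨not_le.1 fun h => h3 ⟨h, h2⟩, h1⟩, h2⟩
  rw [← h1, ← h1, ← measureReal_sdiff (prod_mono le_rfl (Iic_subset_Iic.2 hcd))
    (measurableSet_Ioc.prod measurableSet_Iic)]
  congr 1
  ext ⟨p, q⟩
  simp only [mem_prod, mem_Ioc, mem_Iic, Set.mem_sdiff]
  constructor
  · rintro ⟨h1, h2, h3⟩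
    exact ⟨⟨h1, h3⟩, fun h => absurd h.2 (not_le.2 h2)⟩
  · rintro ⟨⟨h1, h2⟩, h3⟩
    exact ⟨h1, not_le.1 fun h => h3 ⟨h1, h⟩, h2⟩

/-- Convergence of distribution functions implies weak convergence, for probability measures on
the unit square. -/
lemma tendsto_integral_of_tendsto_cdf {μs : ℕ → Measure (ℝ × ℝ)} {μ : Measure (ℝ × ℝ)}
    [hs : ∀ m, IsProbabilityMeasure (μs m)] [h0 : IsProbabilityMeasure μ]
    (hμs : ∀ m, μs m (Icc (0 : ℝ) 1 ×ˢ Icc (0 : ℝ) 1) = 1)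
    (hμ : μ (Icc (0 : ℝ) 1 ×ˢ Icc (0 : ℝ) 1) = 1)
    (h : ∀ x ∈ Icc (0 : ℝ) 1, ∀ y ∈ Icc (0 : ℝ) 1,
      Tendsto (fun m => (μs m).real (Iic x ×ˢ Iic y)) atTop (nhds (μ.real (Iic x ×ˢ Iic y))))
    (g : BoundedContinuousFunction (ℝ × ℝ) ℝ) :
    Tendsto (fun m => ∫ z, g z ∂(μs m)) atTop (nhds (∫ z, g z ∂μ)) := by
  have h1 : ∀ x y : ℝ,
      Tendsto (fun m => (μs m).real (Iic x ×ˢ Iic y)) atTop (nhds (μ.real (Iic x ×ˢ Iic y))) := by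
    intro x y
    have e : ∀ ν : Measure (ℝ × ℝ), IsProbabilityMeasure ν →
        ν (Icc (0 : ℝ) 1 ×ˢ Icc (0 : ℝ) 1) = 1 →
        ν.real (Iic x ×ˢ Iic y) =
          if 0 ≤ x ∧ 0 ≤ y then ν.real (Iic (min x 1) ×ˢ Iic (min y 1)) else 0 := by
      intro ν _ hν
      split_ifs with hxy
      · rw [← measureReal_inter_of_eq_one hν, Iic_prod_inter, measureReal_inter_of_eq_one hν]
      · rw [← measureReal_inter_of_eq_one hν]
        convert measureReal_empty
        ext ⟨a, b⟩
        simp only [mem_inter_iff, mem_prod, mem_Iic, mem_Icc, mem_empty_iff_false, iff_false]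
        rintro ⟨⟨h1, h2⟩, ⟨h3, -⟩, h4, -⟩
        exact hxy ⟨h3.trans h1, h4.trans h2⟩
    simp only [e _ (hs _) (hμs _), e _ h0 hμ]
    split_ifs with hxy
    · exact h _ ⟨le_min hxy.1 zero_le_one, min_le_right _ _⟩ _
        ⟨le_min hxy.2 zero_le_one, min_le_right _ _⟩
    · exact tendsto_const_nhds
  let P : ℕ → ProbabilityMeasure (ℝ × ℝ) := fun m => ⟨μs m, hs m⟩
  let Q : ProbabilityMeasure (ℝ × ℝ) := ⟨μ, h0⟩
  have key : Tendsto P atTop (nhds Q) := by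
    refine IsPiSystem.tendsto_probabilityMeasure_of_tendsto_of_mem
      (S := {A | ∃ a b c d : ℝ, A = Ioc a b ×ˢ Ioc c d}) ?_ ?_ ?_ ?_
    · rintro _ ⟨a, b, c, d, rfl⟩ _ ⟨a', b', c', d', rfl⟩ -
      exact ⟨a ⊔ a', b ⊓ b', c ⊔ c', d ⊓ d', by rw [prod_inter_prod, Ioc_inter_Ioc, Ioc_inter_Ioc]⟩
    · rintro _ ⟨a, b, c, d, rfl⟩
      exact measurableSet_Ioc.prod measurableSet_Ioc
    · rintro u hu ⟨x, y⟩ hxy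
      obtain ⟨ε, hε, hball⟩ := Metric.isOpen_iff.1 hu _ hxy
      refine ⟨_, ⟨x - ε / 2, x + ε / 2, y - ε / 2, y + ε / 2, rfl⟩, ?_, ?_⟩
      · exact prod_mem_nhds (Ioc_mem_nhds (by linarith) (by linarith))
          (Ioc_mem_nhds (by linarith) (by linarith))
      · rintro ⟨a, b⟩ ⟨⟨h1, h2⟩, h3, h4⟩
        refine hball ?_
        simp only at h1 h2 h3 h4
        rw [Metric.mem_ball, Prod.dist_eq, max_lt_iff, Real.dist_eq, Real.dist_eq, abs_lt, abs_lt]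
        refine ⟨⟨?_, ?_⟩, ?_, ?_⟩ <;> simp only <;> linarith
    · rintro _ ⟨a, b, c, d, rfl⟩
      rw [← NNReal.tendsto_coe]
      change Tendsto (fun m => (μs m).real (Ioc a b ×ˢ Ioc c d)) atTop
        (nhds (μ.real (Ioc a b ×ˢ Ioc c d)))
      rcases le_or_gt a b with hab | hab
      · rcases le_or_gt c d with hcd | hcd
        · simp only [measureReal_Ioc_prod_Ioc _ hab hcd]
          exact ((h1 _ _).sub (h1 _ _)).sub ((h1 _ _).sub (h1 _ _))
        · simp [Ioc_eq_empty_of_le hcd.le]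
      · simp [Ioc_eq_empty_of_le hab.le]
  exact ProbabilityMeasure.tendsto_iff_forall_integral_tendsto.1 key g

end WeakConvergence

section PermutonOfPerm

/-- The support cell of the permuton of `σ` in the column `i`. -/
def permCell {n : ℕ} (σ : Equiv.Perm (Fin n)) (i : Fin n) : Set (ℝ × ℝ) :=
  Icc (((i : ℕ) : ℝ) / n) ((((i : ℕ) : ℝ) + 1) / n) ×ˢ
    Icc ((((σ i : Fin n) : ℕ) : ℝ) / n) (((((σ i : Fin n) : ℕ) : ℝ) + 1) / n)

variable {n : ℕ}

lemma volume_biUnion_permCell (hn : 1 ≤ n) (σ : Equiv.Perm (Fin n)) (S : Finset (Fin n)) :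
    (n : ENNReal) * volume (⋃ i ∈ S, permCell σ i) = ENNReal.ofReal (S.card / n) := by
  have hn' : (0 : ℝ) < n := by exact_mod_cast hn
  have e : (n : ENNReal) * (S.card * ENNReal.ofReal (1 / n * (1 / n))) =
      ENNReal.ofReal (S.card / n) := by
    rw [← ENNReal.ofReal_natCast n, ← ENNReal.ofReal_natCast S.card,
      ← ENNReal.ofReal_mul (by positivity), ← ENNReal.ofReal_mul (by positivity)]
    congr 1
    field_simp
  rw [← e]
  congr 1
  refine le_antisymm ?_ ?_
  · refine (measure_biUnion_finset_le _ _).trans (le_of_eq ?_)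
    rw [← nsmul_eq_mul, ← Finset.sum_const]
    refine Finset.sum_congr rfl fun i _ => ?_
    rw [permCell, Measure.volume_eq_prod, Measure.prod_prod, Real.volume_Icc, Real.volume_Icc,
      ← ENNReal.ofReal_mul (by rw [← sub_div]; simp)]
    congr 1
    ring
  · let C : Fin n → Set (ℝ × ℝ) := fun i =>
      Ioo (((i : ℕ) : ℝ) / n) ((((i : ℕ) : ℝ) + 1) / n) ×ˢ
        Ioo ((((σ i : Fin n) : ℕ) : ℝ) / n) (((((σ i : Fin n) : ℕ) : ℝ) + 1) / n)
    have hC : ∀ i, C i ⊆ permCell σ i := fun i => prod_mono Ioo_subset_Icc_self Ioo_subset_Icc_self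
    refine le_trans (le_of_eq ?_) (measure_mono (biUnion_mono (s := (S : Set (Fin n)))
      (s' := (S : Set (Fin n))) le_rfl fun i _ => hC i))
    simp only [Finset.mem_coe]
    rw [measure_biUnion_finset]
    · rw [← nsmul_eq_mul, ← Finset.sum_const]
      refine Finset.sum_congr rfl fun i _ => ?_
      simp only [C]
      rw [Measure.volume_eq_prod, Measure.prod_prod, Real.volume_Ioo, Real.volume_Ioo,
        ← ENNReal.ofReal_mul (by rw [← sub_div]; simp)]
      congr 1
      ring
    · intro i _ j _ hij
      refine Set.disjoint_left.2 ?_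
      rintro ⟨a, b⟩ ⟨⟨h1, h2⟩, -⟩ ⟨⟨h3, h4⟩, -⟩
      simp only [div_lt_iff₀ hn', lt_div_iff₀ hn'] at h1 h2 h3 h4
      have h5 : ((i : ℕ) : ℝ) < (j : ℕ) + 1 := h1.trans h4
      have h6 : ((j : ℕ) : ℝ) < (i : ℕ) + 1 := h3.trans h2
      have h5 : (i : ℕ) < j + 1 := by exact_mod_cast h5
      have h6 : (j : ℕ) < i + 1 := by exact_mod_cast h6
      exact hij (Fin.ext (by omega))
    · exact fun i _ => measurableSet_Ioo.prod measurableSet_Ioo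

lemma permutonOfPerm_apply (σ : Equiv.Perm (Fin n)) {A : Set (ℝ × ℝ)} (hA : MeasurableSet A) :
    permutonOfPerm σ A = n * volume (A ∩ ⋃ i, permCell σ i) := by
  rw [permutonOfPerm, Measure.smul_apply, smul_eq_mul, Measure.restrict_apply hA]
  rfl

lemma le_permutonOfPerm (hn : 1 ≤ n) (σ : Equiv.Perm (Fin n)) {A : Set (ℝ × ℝ)}
    (hA : MeasurableSet A) {S : Finset (Fin n)} (hS : ∀ i ∈ S, permCell σ i ⊆ A) :
    ENNReal.ofReal (S.card / n) ≤ permutonOfPerm σ A := by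
  rw [permutonOfPerm_apply σ hA, ← volume_biUnion_permCell hn σ]
  gcongr
  exact iUnion₂_subset fun i hi => subset_inter (hS i hi) (subset_iUnion _ i)

lemma permutonOfPerm_le (hn : 1 ≤ n) (σ : Equiv.Perm (Fin n)) {A : Set (ℝ × ℝ)}
    (hA : MeasurableSet A) {S : Finset (Fin n)} (hS : ∀ i, (permCell σ i ∩ A).Nonempty → i ∈ S) :
    permutonOfPerm σ A ≤ ENNReal.ofReal (S.card / n) := by
  rw [permutonOfPerm_apply σ hA, ← volume_biUnion_permCell hn σ]
  gcongr
  rintro z ⟨hz, hz'⟩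
  obtain ⟨i, hi⟩ := mem_iUnion.1 hz'
  exact mem_biUnion (hS i ⟨z, hi, hz⟩) hi

lemma permCell_subset (hn : 1 ≤ n) (σ : Equiv.Perm (Fin n)) (i : Fin n) :
    permCell σ i ⊆ Icc (0 : ℝ) 1 ×ˢ Icc (0 : ℝ) 1 := by
  have hn' : (0 : ℝ) < n := by exact_mod_cast hn
  have h : ∀ j : Fin n, Icc (((j : ℕ) : ℝ) / n) ((((j : ℕ) : ℝ) + 1) / n) ⊆ Icc (0 : ℝ) 1 := by
    intro j
    refine Icc_subset_Icc (by positivity) ?_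
    rw [div_le_one hn']
    exact_mod_cast j.2
  exact prod_mono (h i) (h (σ i))

lemma permutonOfPerm_unitSquare (hn : 1 ≤ n) (σ : Equiv.Perm (Fin n)) :
    permutonOfPerm σ (Icc (0 : ℝ) 1 ×ˢ Icc (0 : ℝ) 1) = 1 := by
  have hn' : (0 : ℝ) < n := by exact_mod_cast hn
  have hm : MeasurableSet (Icc (0 : ℝ) 1 ×ˢ Icc (0 : ℝ) 1) :=
    measurableSet_Icc.prod measurableSet_Icc
  have h1 := le_permutonOfPerm hn σ hm (S := Finset.univ) fun i _ => permCell_subset hn σ i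
  have h2 := permutonOfPerm_le hn σ hm (S := Finset.univ) fun i _ => Finset.mem_univ i
  simp only [Finset.card_univ, Fintype.card_fin, div_self hn'.ne', ENNReal.ofReal_one] at h1 h2
  exact le_antisymm h2 h1

lemma isProbabilityMeasure_permutonOfPerm (hn : 1 ≤ n) (σ : Equiv.Perm (Fin n)) :
    IsProbabilityMeasure (permutonOfPerm σ) := by
  have hn' : (0 : ℝ) < n := by exact_mod_cast hn
  constructor
  refine le_antisymm ?_ ((permutonOfPerm_unitSquare hn σ).symm.le.trans
    (measure_mono (subset_univ _)))
  have h2 := permutonOfPerm_le hn σ MeasurableSet.univ (S := Finset.univ)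
    fun i _ => Finset.mem_univ i
  simpa only [Finset.card_univ, Fintype.card_fin, div_self hn'.ne', ENNReal.ofReal_one] using h2

lemma card_filter_lt_and_lt (σ : Equiv.Perm (Fin n)) {k : ℕ} (hk : k ≤ n) (l : ℕ) :
    ((Finset.univ.filter (fun i : Fin n => (i : ℕ) < k ∧ ((σ i : Fin n) : ℕ) < l)).card : ℝ) =
      k - exceedCount σ k l := by
  have h := Finset.card_filter_add_card_filter_not
    (s := Finset.univ.filter (fun i : Fin n => (i : ℕ) < k)) (fun i => ((σ i : Fin n) : ℕ) < l)
  rw [card_filter_pos_lt hk, Finset.filter_filter, Finset.filter_filter] at h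
  simp only [not_lt] at h
  rw [eq_sub_iff_add_eq]
  exact_mod_cast h

/-- Convergence of the rectangular counts gives convergence of the distribution functions of the
associated permutons. -/
lemma tendsto_permutonOfPerm_of_tendsto_exceedCount {ν : ℕ → ℕ} (hν : ∀ m, m + 1 ≤ ν m)
    (σ : (m : ℕ) → Equiv.Perm (Fin (ν m))) {x y F : ℝ} (hx : x ∈ Icc (0 : ℝ) 1)
    (hy : y ∈ Icc (0 : ℝ) 1)
    (h : ∀ k l : ℕ → ℕ, (∀ m, k m ≤ ν m) → (∀ m, l m ≤ ν m) →
      Tendsto (fun m => (k m : ℝ) / ν m) atTop (nhds x) →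
      Tendsto (fun m => (l m : ℝ) / ν m) atTop (nhds y) →
      Tendsto (fun m => (exceedCount (σ m) (k m) (l m) : ℝ) / ν m) atTop (nhds (x - F))) :
    Tendsto (fun m => (permutonOfPerm (σ m)).real (Iic x ×ˢ Iic y)) atTop (nhds F) := by
  have hν1 : ∀ m, 1 ≤ ν m := fun m => by have := hν m; omega
  have hν0 : ∀ m, (0 : ℝ) < ν m := fun m => by exact_mod_cast hν1 m
  have hνt : Tendsto ν atTop atTop :=
    tendsto_atTop_mono (fun m => (Nat.le_succ m).trans (hν m)) tendsto_id
  have f1 : ∀ z ∈ Icc (0 : ℝ) 1, ∀ m, ⌊z * ν m⌋₊ ≤ ν m := fun z hz m => by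
    refine Nat.floor_le_of_le ?_
    have := mul_le_mul_of_nonneg_right hz.2 (hν0 m).le
    linarith
  have f2 : ∀ z ∈ Icc (0 : ℝ) 1,
      Tendsto (fun m => (⌊z * ν m⌋₊ : ℝ) / ν m) atTop (nhds z) := fun z hz =>
    (tendsto_nat_floor_mul_div_atTop hz.1).comp (tendsto_natCast_atTop_atTop.comp hνt)
  have f3 : ∀ z ∈ Icc (0 : ℝ) 1,
      Tendsto (fun m => ((min (⌊z * ν m⌋₊ + 1) (ν m) : ℕ) : ℝ) / ν m) atTop (nhds z) := by
    intro z hz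
    have e : ∀ m, ((min (⌊z * ν m⌋₊ + 1) (ν m) : ℕ) : ℝ) / ν m =
        min ((⌊z * ν m⌋₊ : ℝ) / ν m + 1 / ν m) 1 := by
      intro m
      have := hν0 m
      rw [← add_div, Nat.cast_min, ← min_div_div_right this.le, div_self this.ne']
      push_cast
      rfl
    simp only [e]
    have h1 : Tendsto (fun m => 1 / (ν m : ℝ)) atTop (nhds 0) :=
      tendsto_one_div_atTop_nhds_zero_nat.comp hνt
    have := ((f2 z hz).add h1).min (tendsto_const_nhds (x := (1 : ℝ)))
    rwa [add_zero, min_eq_left hz.2] at this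
  have hA : MeasurableSet (Iic x ×ˢ Iic y) := measurableSet_Iic.prod measurableSet_Iic
  have lim1 := (f2 x hx).sub (h _ _ (f1 x hx) (f1 y hy) (f2 x hx) (f2 y hy))
  have lim2 := (f3 x hx).sub (h _ _ (fun m => min_le_right _ _) (fun m => min_le_right _ _)
    (f3 x hx) (f3 y hy))
  rw [sub_sub_cancel] at lim1 lim2
  refine tendsto_of_tendsto_of_tendsto_of_le_of_le lim1 lim2 (fun m => ?_) (fun m => ?_)
  · have := isProbabilityMeasure_permutonOfPerm (hν1 m) (σ m)
    dsimp only
    rw [← sub_div, ← card_filter_lt_and_lt (σ m) (f1 x hx m), measureReal_def,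
      ← ENNReal.ofReal_le_iff_le_toReal (measure_ne_top _ _)]
    refine le_permutonOfPerm (hν1 m) (σ m) hA fun i hi => ?_
    have hi := (Finset.mem_filter.1 hi).2
    have g : ∀ z ∈ Icc (0 : ℝ) 1, ∀ j : ℕ, j < ⌊z * ν m⌋₊ → ((j : ℝ) + 1) / ν m ≤ z := by
      intro z hz j hj
      rw [div_le_iff₀ (hν0 m)]
      have h1 : ((j + 1 : ℕ) : ℝ) ≤ ⌊z * ν m⌋₊ := by exact_mod_cast hj
      have h2 := Nat.floor_le (mul_nonneg hz.1 (hν0 m).le)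
      push_cast at h1
      linarith
    exact prod_mono (fun z hz => hz.2.trans (g x hx _ hi.1)) fun z hz => hz.2.trans (g y hy _ hi.2)
  · have := isProbabilityMeasure_permutonOfPerm (hν1 m) (σ m)
    dsimp only
    rw [← sub_div, ← card_filter_lt_and_lt (σ m) (min_le_right _ _), measureReal_def]
    refine ENNReal.toReal_le_of_le_ofReal (by positivity) ?_
    refine permutonOfPerm_le (hν1 m) (σ m) hA fun i hi => ?_
    obtain ⟨⟨a, b⟩, ⟨⟨h1, -⟩, h2, -⟩, h3, h4⟩ := hi
    have g : ∀ z : ℝ, ∀ j : Fin (ν m), ((j : ℕ) : ℝ) / ν m ≤ z →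
        (j : ℕ) < min (⌊z * ν m⌋₊ + 1) (ν m) := by
      intro z j hj
      rw [div_le_iff₀ (hν0 m)] at hj
      have := Nat.le_floor hj
      have := j.2
      omega
    exact Finset.mem_filter.2 ⟨Finset.mem_univ _, g x i (h1.trans h3), g y (σ m i) (h2.trans h4)⟩

end PermutonOfPerm

lemma MetrizesWeakConvUnitSq.exists_forall_le {d : Measure (ℝ × ℝ) → Measure (ℝ × ℝ) → ℝ}
    (hd : MetrizesWeakConvUnitSq d) {μ : Measure (ℝ × ℝ)} [IsProbabilityMeasure μ]
    (hμ : μ (Icc (0 : ℝ) 1 ×ˢ Icc (0 : ℝ) 1) = 1)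
    (Good : ℝ → (n : ℕ) → Equiv.Perm (Fin n) → Prop)
    (h : ∀ (ν : ℕ → ℕ) (σ : (m : ℕ) → Equiv.Perm (Fin (ν m))), (∀ m, m + 1 ≤ ν m) →
      (∀ m : ℕ, Good (1 / ((m : ℝ) + 1)) (ν m) (σ m)) →
      ∀ x ∈ Icc (0 : ℝ) 1, ∀ y ∈ Icc (0 : ℝ) 1,
        Tendsto (fun m => (permutonOfPerm (σ m)).real (Iic x ×ˢ Iic y)) atTop
          (nhds (μ.real (Iic x ×ˢ Iic y))))
    {ε : ℝ} (hε : 0 < ε) :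
    ∃ δ > 0, ∃ N, ∀ n ≥ N, ∀ σ : Equiv.Perm (Fin n), Good δ n σ →
      d (permutonOfPerm σ) μ ≤ ε := by
  by_contra! hc
  have hc' := fun m : ℕ => hc (1 / ((m : ℝ) + 1)) (by positivity) (m + 1)
  choose ν hν σ hσ hdσ using hc'
  have hν1 : ∀ m, 1 ≤ ν m := fun m => by have := hν m; omega
  have hp : ∀ m, IsProbabilityMeasure (permutonOfPerm (σ m)) := fun m =>
    isProbabilityMeasure_permutonOfPerm (hν1 m) (σ m)
  have hsq := fun m => permutonOfPerm_unitSquare (hν1 m) (σ m)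
  have hlim := (hd (fun m => permutonOfPerm (σ m)) μ hp inferInstance hsq hμ).2
    (tendsto_integral_of_tendsto_cdf hsq hμ (h ν σ hν hσ))
  obtain ⟨m, hm⟩ := (hlim.eventually_lt_const hε).exists
  exact absurd hm (not_lt.2 (hdσ m).le)

section CountLimit

lemma abs_exceedCount_div_sub_le {n : ℕ} (hn : 1 ≤ n) {σ : Equiv.Perm (Fin n)} {δ : ℝ}
    (hσ : (invCount σ : ℝ) ≤ δ * n ^ 2) {k l : ℕ} (hk : k ≤ n) (hl : l ≤ n) :
    |(exceedCount σ k l : ℝ) / n - (k / n - min ((k : ℝ) / n) (l / n))| ≤ √δ := by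
  have hn' : (0 : ℝ) < n := by exact_mod_cast hn
  obtain ⟨c, hc, hc'⟩ : ∃ c : ℕ, (exceedCount σ k l : ℝ) = k - min (k : ℝ) l + c ∧
      c * c ≤ invCount σ := by
    rcases le_total k l with h | h
    · refine ⟨exceedCount σ k l, ?_, exceedCount_sq_le σ hk h hl⟩
      rw [min_eq_left (by exact_mod_cast h)]
      ring
    · obtain ⟨c, hc, hc'⟩ := exceedCount_add_sub_sq_le σ hk h
      refine ⟨c, ?_, hc'⟩
      rw [min_eq_right (by exact_mod_cast h)]
      have : (exceedCount σ k l : ℝ) + l = k + c := by exact_mod_cast hc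
      linarith
  have e : (exceedCount σ k l : ℝ) / n - (k / n - min ((k : ℝ) / n) (l / n)) = c / n := by
    rw [hc, min_div_div_right hn'.le]
    ring
  rw [e, abs_of_nonneg (by positivity)]
  refine Real.le_sqrt_of_sq_le ?_
  have : (c : ℝ) * c ≤ invCount σ := by exact_mod_cast hc'
  rw [div_pow, div_le_iff₀ (by positivity)]
  linarith

lemma tendsto_exceedCount_of_invCount {ν : ℕ → ℕ} (hν : ∀ m, m + 1 ≤ ν m)
    (σ : (m : ℕ) → Equiv.Perm (Fin (ν m)))
    (hσ : ∀ m : ℕ, (invCount (σ m) : ℝ) ≤ 1 / ((m : ℝ) + 1) * ν m ^ 2) {x y : ℝ}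
    {k l : ℕ → ℕ} (hk : ∀ m, k m ≤ ν m) (hl : ∀ m, l m ≤ ν m)
    (hkx : Tendsto (fun m => (k m : ℝ) / ν m) atTop (nhds x))
    (hly : Tendsto (fun m => (l m : ℝ) / ν m) atTop (nhds y)) :
    Tendsto (fun m => (exceedCount (σ m) (k m) (l m) : ℝ) / ν m) atTop
      (nhds (x - min x y)) := by
  have h1 := (hkx.sub (hkx.min hly))
  have h2 : Tendsto (fun m : ℕ => √(1 / ((m : ℝ) + 1))) atTop (nhds 0) := by
    have := (Real.continuous_sqrt.tendsto 0).comp (tendsto_one_div_add_atTop_nhds_zero_nat (𝕜 := ℝ))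
    rwa [Real.sqrt_zero] at this
  have h3 := squeeze_zero_norm (fun m => (Real.norm_eq_abs _).trans_le <| abs_exceedCount_div_sub_le
    (by have := hν m; omega) (hσ m) (hk m) (hl m)) h2
  have := h3.add h1
  simpa using this

/-- The rescaled function `tailMin` is uniformly within `δ` of the curve `f231 β`. -/
def IsCloseToCurve (β δ : ℝ) {n : ℕ} (σ : Equiv.Perm (Fin n)) : Prop :=
  ∀ k ≤ n, |(tailMin σ k : ℝ) / n - f231 β (k / n)| ≤ δ

variable {β δ : ℝ} {n : ℕ} {σ : Equiv.Perm (Fin n)}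

lemma le_f231_lastPos (hn : 1 ≤ n) (hσ : IsCloseToCurve β δ σ) {l : ℕ} (hl : l ≤ n) :
    (l : ℝ) / n ≤ f231 β (lastPos σ l / n) + δ := by
  have hn' : (0 : ℝ) < n := by exact_mod_cast hn
  have h1 := (abs_le.1 (hσ _ (lastPos_le_top σ hl))).2
  have h2 : (l : ℝ) / n ≤ (tailMin σ (lastPos σ l) : ℝ) / n := by
    gcongr
    exact le_tailMin_lastPos σ hl
  linarith

lemma f231_lastPos_le (hβ : 0 < β) (hδ : 0 ≤ δ) (hn : 1 ≤ n) (hσ : IsCloseToCurve β δ σ) {l : ℕ}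
    (hl : l ≤ n) : f231 β (lastPos σ l / n) ≤ l / n + (δ + Real.exp β / n) := by
  have hn' : (0 : ℝ) < n := by exact_mod_cast hn
  rcases Nat.eq_zero_or_pos (lastPos σ l) with h0 | h0
  · rw [h0, Nat.cast_zero, zero_div, f231_zero hβ]
    positivity
  · obtain ⟨K, hK⟩ : ∃ K, lastPos σ l = K + 1 := ⟨lastPos σ l - 1, by omega⟩
    have hKn := lastPos_le_top σ hl
    have h1 := (abs_le.1 (hσ K (by omega))).1
    have h2 : (tailMin σ K : ℝ) / n ≤ l / n := by
      gcongr
      exact (tailMin_lt_of_lt_lastPos σ (by omega)).le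
    have hK1 : ((K + 1 : ℕ) : ℝ) / n ≤ 1 := by
      rw [div_le_one hn']; exact_mod_cast hK ▸ hKn
    have hK2 : (K : ℝ) / n ≤ 1 := le_trans (by gcongr; simp) hK1
    have h3 := (abs_le.1 (abs_f231_sub_le hβ hK1 hK2)).2
    have e : |((K + 1 : ℕ) : ℝ) / n - K / n| = 1 / n := by
      rw [← sub_div, Nat.cast_succ, add_sub_cancel_left, abs_of_nonneg (by positivity)]
    rw [e, mul_one_div] at h3
    rw [hK]
    linarith

lemma abs_exceedCount_div_sub_le_of_isCloseToCurve (hβ : 0 < β) (hδ : 0 ≤ δ) (hn : 1 ≤ n)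
    (hav : Avoids231 σ) (hσ : IsCloseToCurve β δ σ) {k l : ℕ} (hk : k ≤ n) (hl : l ≤ n) :
    |(exceedCount σ k l : ℝ) / n - min ((k : ℝ) / n - min ((l : ℝ) / n) (f231 β (k / n)))
      (max ((k : ℝ) / n) (lastPos σ l / n) - l / n)| ≤ 2 * δ + Real.exp β / n := by
  have hn' : (0 : ℝ) < n := by exact_mod_cast hn
  have hE : 0 ≤ Real.exp β / n := by positivity
  have hKn := lastPos_le_top σ hl
  have hg := abs_le.1 (hσ k hk)
  set a : ℝ := (exceedCount σ k l : ℝ) / n with ha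
  set x : ℝ := (k : ℝ) / n with hx
  set y : ℝ := (l : ℝ) / n with hy
  set κ : ℝ := (lastPos σ l : ℝ) / n with hκ
  have u1 : a ≤ x - min y ((tailMin σ k : ℝ) / n) := by
    have : (exceedCount σ k l : ℝ) + min (l : ℝ) (tailMin σ k) ≤ k := by
      exact_mod_cast exceedCount_add_min_le σ hk
    rw [hx, hy, min_div_div_right hn'.le, le_sub_iff_add_le, ha, ← add_div]
    gcongr
  have u2 : a ≤ max x κ - y := by
    have : (exceedCount σ k l : ℝ) + l ≤ max (k : ℝ) (lastPos σ l) := by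
      exact_mod_cast exceedCount_add_le_max σ hk hl
    rw [hx, hκ, max_div_div_right hn'.le, le_sub_iff_add_le, ha, ← add_div]
    gcongr
  have u3 : min y (f231 β x) - δ ≤ min y ((tailMin σ k : ℝ) / n) := by
    refine le_min ?_ ?_
    · linarith [min_le_left y (f231 β x)]
    · linarith [min_le_right y (f231 β x)]
  have hup : a ≤ min (x - min y (f231 β x)) (max x κ - y) + δ := by
    rw [← sub_le_iff_le_add]
    exact le_min (by linarith) (by linarith)
  have hlow : min (x - min y (f231 β x)) (max x κ - y) - (2 * δ + Real.exp β / n) ≤ a := by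
    rcases le_or_gt l (tailMin σ k) with h | h
    · have e : a = x - y := by
        have : (exceedCount σ k l : ℝ) + l = k := by
          exact_mod_cast exceedCount_add_of_le_tailMin σ hk h
        rw [ha, hx, hy, ← this]
        ring
      have h1 : y ≤ (tailMin σ k : ℝ) / n := by
        rw [hy]; gcongr
      have h2 : y - δ ≤ min y (f231 β x) := le_min (by linarith) (by linarith)
      linarith [min_le_left (x - min y (f231 β x)) (max x κ - y)]
    · obtain ⟨K, hkK, hK, hKa⟩ := exists_le_exceedCount_add hav hk hl h
      have hK1 : K ≤ n := hK.trans hKn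
      have h1 : (K : ℝ) / n - (tailMin σ K : ℝ) / n ≤ a := by
        have : (K : ℝ) ≤ exceedCount σ k l + tailMin σ K := by exact_mod_cast hKa
        rw [← sub_div, ha]
        gcongr
        linarith
      have h2 := (abs_le.1 (hσ K hK1)).2
      have hxK : x ≤ (K : ℝ) / n := by rw [hx]; gcongr
      have hKκ : (K : ℝ) / n ≤ κ := by rw [hκ]; gcongr
      have hκ1 : κ ≤ 1 := by rw [hκ, div_le_one hn']; exact_mod_cast hKn
      have h3 := min_sub_f231_le hβ hxK hKκ hκ1
      have h4 := f231_lastPos_le hβ hδ hn hσ hl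
      have h5 : (tailMin σ k : ℝ) / n ≤ y := by rw [hy]; gcongr
      have h6 : f231 β x - δ ≤ min y (f231 β x) := le_min (by linarith) (by linarith)
      rw [max_eq_right (hxK.trans hKκ)]
      have m1 := min_le_left (x - min y (f231 β x)) (κ - y)
      have m2 := min_le_right (x - min y (f231 β x)) (κ - y)
      rcases min_le_iff.1 h3 with h | h <;> linarith
  rw [abs_le]
  constructor <;> linarith

lemma tendsto_exceedCount_of_isCloseToCurve (hβ : 0 < β) {ν : ℕ → ℕ} (hν : ∀ m, m + 1 ≤ ν m)
    (σ : (m : ℕ) → Equiv.Perm (Fin (ν m))) (hav : ∀ m, Avoids231 (σ m))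
    (hσ : ∀ m : ℕ, IsCloseToCurve β (1 / ((m : ℝ) + 1)) (σ m)) {x y : ℝ}
    (hx : x ∈ Icc (0 : ℝ) 1) (hy : y ∈ Icc (0 : ℝ) 1)
    {k l : ℕ → ℕ} (hk : ∀ m, k m ≤ ν m) (hl : ∀ m, l m ≤ ν m)
    (hkx : Tendsto (fun m => (k m : ℝ) / ν m) atTop (nhds x))
    (hly : Tendsto (fun m => (l m : ℝ) / ν m) atTop (nhds y)) :
    Tendsto (fun m => (exceedCount (σ m) (k m) (l m) : ℝ) / ν m) atTop
      (nhds (min (x - min y (f231 β x)) (max x (1 - f231 β (1 - y)) - y))) := by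
  have hν1 : ∀ m, 1 ≤ ν m := fun m => by have := hν m; omega
  have hν0 : ∀ m, (0 : ℝ) < ν m := fun m => by exact_mod_cast hν1 m
  have hνt : Tendsto ν atTop atTop :=
    tendsto_atTop_mono (fun m => (Nat.le_succ m).trans (hν m)) tendsto_id
  have hδ : Tendsto (fun m : ℕ => 1 / ((m : ℝ) + 1)) atTop (nhds 0) :=
    tendsto_one_div_add_atTop_nhds_zero_nat
  have hE : Tendsto (fun m => Real.exp β / (ν m : ℝ)) atTop (nhds 0) :=
    (tendsto_const_div_atTop_nhds_zero_nat _).comp hνt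
  have hδ0 : ∀ m : ℕ, 0 ≤ 1 / ((m : ℝ) + 1) := fun m => by positivity
  have hf : ∀ z ≤ 1, ContinuousAt (f231 β) z := fun z hz => (hasDerivAt_f231 hβ hz).continuousAt
  have hfκ : Tendsto (fun m => f231 β (lastPos (σ m) (l m) / ν m)) atTop (nhds y) := by
    have t1 := hly.sub hδ
    have t2 := hly.add (hδ.add hE)
    simp only [sub_zero, add_zero] at t1 t2
    refine tendsto_of_tendsto_of_tendsto_of_le_of_le t1 t2 (fun m => ?_) fun m => ?_
    · have := le_f231_lastPos (hν1 m) (hσ m) (hl m)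
      dsimp only
      linarith
    · exact f231_lastPos_le hβ (hδ0 m) (hν1 m) (hσ m) (hl m)
  have hκ : Tendsto (fun m => (lastPos (σ m) (l m) : ℝ) / ν m) atTop
      (nhds (1 - f231 β (1 - y))) := by
    have h1 := ((hf (1 - y) (by linarith [hy.1])).tendsto.comp (hfκ.const_sub 1)).const_sub 1
    refine h1.congr fun m => ?_
    have : (lastPos (σ m) (l m) : ℝ) / ν m ≤ 1 := by
      rw [div_le_one (hν0 m)]
      exact_mod_cast lastPos_le_top (σ m) (hl m)
    simp only [Function.comp]
    rw [f231_one_sub_f231 hβ this]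
    ring
  have h1 := (hkx.sub (hly.min ((hf x hx.2).tendsto.comp hkx))).min ((hkx.max hκ).sub hly)
  have h2 := (hδ.const_mul 2).add hE
  rw [mul_zero, add_zero] at h2
  have h3 := squeeze_zero_norm (fun m => (Real.norm_eq_abs _).trans_le <|
    abs_exceedCount_div_sub_le_of_isCloseToCurve hβ (hδ0 m) (hν1 m) (hav m) (hσ m) (hk m) (hl m)) h2
  have := h3.add h1
  simpa using this

end CountLimit

section LimitPermuton

lemma eq_volume_restrict_of_measureReal_Iic {ν : Measure ℝ} [IsProbabilityMeasure ν]
    (h : ∀ y ∈ Icc (0 : ℝ) 1, ν.real (Iic y) = y) : ν = volume.restrict (Icc (0 : ℝ) 1) := by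
  have : IsProbabilityMeasure (volume.restrict (Icc (0 : ℝ) 1)) := ⟨by simp⟩
  refine Measure.ext_of_Iic _ _ fun a => ?_
  rw [← measureReal_eq_measureReal_iff]
  have key : ∀ ρ : Measure ℝ, IsProbabilityMeasure ρ →
      (∀ y ∈ Icc (0 : ℝ) 1, ρ.real (Iic y) = y) → ρ.real (Iic a) = max 0 (min a 1) := by
    intro ρ _ hρ
    rcases lt_or_ge a 0 with h0 | h0
    · rw [min_eq_left (by linarith), max_eq_left h0.le]
      refine le_antisymm ?_ measureReal_nonneg
      rw [← hρ 0 (by simp)]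
      exact measureReal_mono (Iic_subset_Iic.2 h0.le)
    rcases lt_or_ge 1 a with h1 | h1
    · rw [min_eq_right h1.le, max_eq_right zero_le_one]
      refine le_antisymm measureReal_le_one ?_
      rw [← hρ 1 (by simp)]
      exact measureReal_mono (Iic_subset_Iic.2 h1.le)
    · rw [hρ a ⟨h0, h1⟩, min_eq_left h1, max_eq_right h0]
  rw [key ν inferInstance h, key _ this fun y hy => ?_]
  have : Iic y ∩ Icc 0 1 = Icc 0 y := by
    ext t
    have := hy.2
    simp only [mem_inter_iff, mem_Iic, mem_Icc]
    grind
  rw [measureReal_restrict_apply measurableSet_Iic, this, Real.volume_real_Icc_of_le hy.1, sub_zero]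

lemma isPermuton_of_measureReal {μ : Measure (ℝ × ℝ)}
    (h1 : μ.map Prod.fst = volume.restrict (Icc (0 : ℝ) 1))
    (h2 : ∀ y ∈ Icc (0 : ℝ) 1, μ.real (Iic 1 ×ˢ Iic y) = y) : IsPermuton μ := by
  have hμ : IsProbabilityMeasure μ := by
    refine ⟨?_⟩
    rw [← preimage_univ (f := Prod.fst), ← Measure.map_apply measurable_fst MeasurableSet.univ, h1]
    simp
  refine ⟨hμ, h1, ?_⟩
  have := Measure.isProbabilityMeasure_map (μ := μ) measurable_snd.aemeasurable
  refine eq_volume_restrict_of_measureReal_Iic fun y hy => ?_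
  rw [map_measureReal_apply measurable_snd measurableSet_Iic]
  refine Eq.trans (measureReal_congr ?_) (h2 y hy)
  have h3 : ∀ᵐ z ∂μ, z.1 ∈ Icc (0 : ℝ) 1 := by
    refine ae_of_ae_map measurable_fst.aemeasurable ?_
    rw [h1]
    exact ae_restrict_mem measurableSet_Icc
  filter_upwards [h3] with z hz
  exact propext ⟨fun h => ⟨hz.2, h⟩, fun h => h.2⟩

lemma IsPermuton.unitSquare {μ : Measure (ℝ × ℝ)} (h : IsPermuton μ) :
    μ (Icc (0 : ℝ) 1 ×ˢ Icc (0 : ℝ) 1) = 1 := by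
  have := h.1
  have h1 : ∀ᵐ z ∂μ, z.1 ∈ Icc (0 : ℝ) 1 := by
    refine ae_of_ae_map measurable_fst.aemeasurable ?_
    rw [h.2.1]
    exact ae_restrict_mem measurableSet_Icc
  have h2 : ∀ᵐ z ∂μ, z.2 ∈ Icc (0 : ℝ) 1 := by
    refine ae_of_ae_map measurable_snd.aemeasurable ?_
    rw [h.2.2]
    exact ae_restrict_mem measurableSet_Icc
  rw [← prob_compl_eq_zero_iff (measurableSet_Icc.prod measurableSet_Icc)]
  filter_upwards [h1, h2] with z a b using ⟨a, b⟩

lemma measureReal_diagPermuton {x y : ℝ} (hx : x ∈ Icc (0 : ℝ) 1) (hy : y ∈ Icc (0 : ℝ) 1) :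
    diagPermuton.real (Iic x ×ˢ Iic y) = min x y := by
  rw [diagPermuton, map_measureReal_apply (by fun_prop) (measurableSet_Iic.prod measurableSet_Iic),
    measureReal_restrict_apply (by measurability)]
  have : (fun x : ℝ => (x, x)) ⁻¹' (Iic x ×ˢ Iic y) ∩ Icc 0 1 = Icc 0 (min x y) := by
    ext t
    simp only [mem_inter_iff, mem_preimage, mem_prod, mem_Iic, mem_Icc, le_min_iff]
    have := hx.2
    grind
  rw [this, Real.volume_real_Icc_of_le (le_min hx.1 hy.1), sub_zero]

lemma isPermuton_diagPermuton : IsPermuton diagPermuton := by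
  refine isPermuton_of_measureReal ?_ fun y hy => ?_
  · rw [diagPermuton, Measure.map_map measurable_fst (by fun_prop)]
    exact Measure.map_id
  · rw [measureReal_diagPermuton (by simp) hy, min_eq_right hy.2]

variable {β : ℝ}

lemma exists_exp_mul_eq (hβ : 0 < β) :
    ∃ x₀ ∈ Ioo (0 : ℝ) 1, Real.exp (β * x₀) = (1 + Real.exp β) / 2 := by
  have h1 : 1 < Real.exp β := Real.one_lt_exp_iff.2 hβ
  have h2 : Real.exp (β * (Real.log ((1 + Real.exp β) / 2) / β)) = (1 + Real.exp β) / 2 := by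
    rw [mul_div_cancel₀ _ hβ.ne', Real.exp_log (by positivity)]
  refine ⟨_, ⟨div_pos (Real.log_pos (by linarith)) hβ, ?_⟩, h2⟩
  have h3 : Real.exp (β * (Real.log ((1 + Real.exp β) / 2) / β)) < Real.exp (β * 1) := by
    rw [h2, mul_one]
    linarith
  exact lt_of_mul_lt_mul_left (Real.exp_lt_exp.1 h3) hβ.le

/-- The integral of the density of the antidiagonal part of `mu231 β` over `[0, z]`, where `x₀` is
the point at which `f231 β` crosses the antidiagonal. -/
def antidiagMass (β x₀ z : ℝ) : ℝ := min z x₀ - f231 β (min z x₀)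

variable {x₀ : ℝ}

lemma f231_eq_one_sub (hβ : 0 < β) (hx₀ : Real.exp (β * x₀) = (1 + Real.exp β) / 2) :
    f231 β x₀ = 1 - x₀ := by
  apply f231_eq_of_exp_add_exp hβ
  rw [sub_sub_cancel, hx₀]
  ring

lemma deriv_f231_eq_one (hβ : 0 < β) (h1 : x₀ ≤ 1)
    (hx₀ : Real.exp (β * x₀) = (1 + Real.exp β) / 2) : deriv (f231 β) x₀ = 1 := by
  have := Real.exp_pos β
  rw [deriv_f231 hβ h1, hx₀, div_eq_one_iff_eq (by linarith)]
  ring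

lemma hasDerivWithinAt_antidiagMass (hβ : 0 < β) (h1 : x₀ ≤ 1)
    (hx₀ : Real.exp (β * x₀) = (1 + Real.exp β) / 2) {z : ℝ} (hz : z ≤ 1) :
    HasDerivWithinAt (antidiagMass β x₀) (max 0 (1 - deriv (f231 β) z)) (Ioi z) z := by
  rcases lt_or_ge z x₀ with h | h
  · have := deriv_f231_mono hβ h.le h1
    rw [deriv_f231_eq_one hβ h1 hx₀] at this
    rw [max_eq_right (by linarith)]
    have hd := (hasDerivAt_id z).sub (hasDerivAt_f231 hβ hz).differentiableAt.hasDerivAt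
    refine (hd.congr_of_eventuallyEq ?_).hasDerivWithinAt
    filter_upwards [Iio_mem_nhds h] with w hw
    simp [antidiagMass, min_eq_left (mem_Iio.1 hw).le]
  · have := deriv_f231_mono hβ h hz
    rw [deriv_f231_eq_one hβ h1 hx₀] at this
    rw [max_eq_left (by linarith)]
    refine (hasDerivWithinAt_const z (Ioi z) (x₀ - f231 β x₀)).congr (fun w hw => ?_) ?_
    · rw [antidiagMass, min_eq_right (h.trans (le_of_lt hw))]
    · rw [antidiagMass, min_eq_right h]

lemma continuous_antidiagMass (hβ : 0 < β) (h1 : x₀ ≤ 1) : Continuous (antidiagMass β x₀) :=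
  (continuous_id.min continuous_const).sub
    ((continuousOn_f231 hβ).comp_continuous (continuous_id.min continuous_const)
      fun _ => (min_le_right _ _).trans h1)

lemma measurable_f231 (β : ℝ) : Measurable (f231 β) := by
  unfold f231
  fun_prop

lemma intervalIntegrable_of_mem_Icc {g : ℝ → ℝ} (hg : Measurable g) {a b : ℝ} (hab : a ≤ b)
    (h : ∀ z ∈ Icc a b, g z ∈ Icc (0 : ℝ) 1) : IntervalIntegrable g volume a b := by
  rw [intervalIntegrable_iff_integrableOn_Icc_of_le hab]
  refine Measure.integrableOn_of_bounded (M := 1) (by simp) hg.aestronglyMeasurable ?_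
  filter_upwards [ae_restrict_mem measurableSet_Icc] with z hz
  rw [Real.norm_of_nonneg (h z hz).1]
  exact (h z hz).2

lemma measureReal_withDensity_eq_integral {g : ℝ → ℝ} (hg : Measurable g)
    (h : ∀ z ∈ Icc (0 : ℝ) 1, g z ∈ Icc (0 : ℝ) 1) {S : Set ℝ} (hS : MeasurableSet S) {a b : ℝ}
    (hab : a ≤ b) (ha : 0 ≤ a) (hb : b ≤ 1) (h1 : Ioc a b ⊆ S) (h2 : S ∩ Icc 0 1 ⊆ Icc a b) :
    ((volume.restrict (Icc (0 : ℝ) 1)).withDensity (fun x => ENNReal.ofReal (g x))).real S =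
      ∫ t in a..b, g t := by
  have e : (S ∩ Icc (0 : ℝ) 1 : Set ℝ) =ᵐ[volume] Ioc a b := by
    refine Filter.EventuallyLE.antisymm ?_ ?_
    · exact (LE.le.eventuallyLE h2).trans Ioc_ae_eq_Icc.symm.le
    · exact LE.le.eventuallyLE fun z hz => ⟨h1 hz, ha.trans hz.1.le, hz.2.trans hb⟩
  rw [Measure.real, withDensity_apply _ hS, Measure.restrict_restrict hS,
    Measure.restrict_congr_set e, intervalIntegral.integral_of_le hab,
    integral_eq_lintegral_of_nonneg_ae ?_ hg.aestronglyMeasurable]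
  filter_upwards [ae_restrict_mem measurableSet_Ioc] with z hz
  exact (h z ⟨ha.trans hz.1.le, hz.2.trans hb⟩).1

lemma integral_antidiag_density (hβ : 0 < β) (h1 : x₀ ≤ 1)
    (hx₀ : Real.exp (β * x₀) = (1 + Real.exp β) / 2) {a b : ℝ} (hab : a ≤ b) (hb : b ≤ 1) :
    ∫ t in a..b, max 0 (1 - deriv (f231 β) t) = antidiagMass β x₀ b - antidiagMass β x₀ a := by
  refine intervalIntegral.integral_eq_sub_of_hasDeriv_right
    (continuous_antidiagMass hβ h1).continuousOn (fun z hz => ?_) ?_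
  · rw [max_eq_right hab] at hz
    exact hasDerivWithinAt_antidiagMass hβ h1 hx₀ (hz.2.le.trans hb)
  · refine intervalIntegrable_of_mem_Icc (by fun_prop) hab fun z hz => ⟨le_max_left _ _, ?_⟩
    exact max_le zero_le_one (by linarith [deriv_f231_nonneg hβ (hz.2.trans hb)])

lemma integral_curve_density (hβ : 0 < β) (h1 : x₀ ≤ 1)
    (hx₀ : Real.exp (β * x₀) = (1 + Real.exp β) / 2) {a b : ℝ} (hab : a ≤ b) (hb : b ≤ 1) :
    ∫ t in a..b, min 1 (deriv (f231 β) t) =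
      b - a - (antidiagMass β x₀ b - antidiagMass β x₀ a) := by
  rw [← integral_antidiag_density hβ h1 hx₀ hab hb, eq_sub_iff_add_eq,
    ← intervalIntegral.integral_add]
  · refine (intervalIntegral.integral_congr (g := fun _ => 1) fun t _ => ?_).trans (by simp)
    dsimp only
    rcases le_total 1 (deriv (f231 β) t) with h | h
    · rw [min_eq_left h, max_eq_left (by linarith), add_zero]
    · rw [min_eq_right h, max_eq_right (by linarith), add_sub_cancel]
  · refine intervalIntegrable_of_mem_Icc (by fun_prop) hab fun z hz => ⟨?_, min_le_left _ _⟩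
    exact le_min zero_le_one (deriv_f231_nonneg hβ (hz.2.trans hb))
  · refine intervalIntegrable_of_mem_Icc (by fun_prop) hab fun z hz => ⟨le_max_left _ _, ?_⟩
    exact max_le zero_le_one (by linarith [deriv_f231_nonneg hβ (hz.2.trans hb)])

lemma mem_Icc_curve_density (hβ : 0 < β) {z : ℝ} (hz : z ∈ Icc (0 : ℝ) 1) :
    min 1 (deriv (f231 β) z) ∈ Icc (0 : ℝ) 1 :=
  ⟨le_min zero_le_one (deriv_f231_nonneg hβ hz.2), min_le_left _ _⟩

lemma mem_Icc_antidiag_density (hβ : 0 < β) {z : ℝ} (hz : z ∈ Icc (0 : ℝ) 1) :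
    max 0 (1 - deriv (f231 β) z) ∈ Icc (0 : ℝ) 1 :=
  ⟨le_max_left _ _, max_le zero_le_one (by linarith [deriv_f231_nonneg hβ hz.2])⟩

lemma map_fst_mu231 (hβ : 0 < β) :
    (mu231 β).map Prod.fst = volume.restrict (Icc (0 : ℝ) 1) := by
  have hf := measurable_f231 β
  rw [mu231, Measure.map_add _ _ measurable_fst, Measure.map_map measurable_fst (by fun_prop),
    Measure.map_map measurable_fst (by fun_prop)]
  change Measure.map id _ + Measure.map id _ = _
  rw [Measure.map_id, Measure.map_id, ← withDensity_add_left (by fun_prop)]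
  refine (withDensity_congr_ae ?_).trans withDensity_one
  filter_upwards [ae_restrict_mem measurableSet_Icc] with z hz
  rw [Pi.add_apply, ← ENNReal.ofReal_add (mem_Icc_curve_density hβ hz).1
    (mem_Icc_antidiag_density hβ hz).1, Pi.one_apply, ← ENNReal.ofReal_one]
  congr 1
  rcases le_total 1 (deriv (f231 β) z) with h | h
  · rw [min_eq_left h, max_eq_left (by linarith), add_zero]
  · rw [min_eq_right h, max_eq_right (by linarith), add_sub_cancel]

lemma isFiniteMeasure_withDensity_ofReal_of_mem_Icc {g : ℝ → ℝ} (hg : Measurable g)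
    (h : ∀ z ∈ Icc (0 : ℝ) 1, g z ∈ Icc (0 : ℝ) 1) :
    IsFiniteMeasure
      ((volume.restrict (Icc (0 : ℝ) 1)).withDensity (fun x => ENNReal.ofReal (g x))) :=
  isFiniteMeasure_withDensity_ofReal ((intervalIntegrable_iff_integrableOn_Icc_of_le
    zero_le_one).1 (intervalIntegrable_of_mem_Icc hg zero_le_one h)).2

lemma measureReal_mu231_eq_antidiagMass (hβ : 0 < β) (hx₀0 : 0 ≤ x₀) (hx₀1 : x₀ ≤ 1)
    (hx₀ : Real.exp (β * x₀) = (1 + Real.exp β) / 2) {x y u : ℝ} (hx : x ∈ Icc (0 : ℝ) 1)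
    (hy : y ∈ Icc (0 : ℝ) 1) (hu : u ∈ Icc (0 : ℝ) 1) (huy : f231 β u = y) :
    (mu231 β).real (Iic x ×ˢ Iic y) = min x u - antidiagMass β x₀ (min x u) +
      (antidiagMass β x₀ x - antidiagMass β x₀ (min x (1 - y))) := by
  have hf := measurable_f231 β
  have hS := measurableSet_Iic (a := x).prod (measurableSet_Iic (a := y))
  have hg1 : Measurable fun z => min 1 (deriv (f231 β) z) := by fun_prop
  have hg2 : Measurable fun z => max 0 (1 - deriv (f231 β) z) := by fun_prop
  have := isFiniteMeasure_withDensity_ofReal_of_mem_Icc hg1 fun z => mem_Icc_curve_density hβ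
  have := isFiniteMeasure_withDensity_ofReal_of_mem_Icc hg2 fun z => mem_Icc_antidiag_density hβ
  have hmono := f231_strictMonoOn hβ
  have e0 : antidiagMass β x₀ 0 = 0 := by
    rw [antidiagMass, min_eq_left hx₀0, f231_zero hβ, sub_zero]
  rw [mu231, measureReal_add_apply, map_measureReal_apply (by fun_prop) hS,
    map_measureReal_apply (by fun_prop) hS,
    measureReal_withDensity_eq_integral hg1 (fun z => mem_Icc_curve_density hβ)
      (MeasurableSet.preimage hS (by fun_prop)) (a := 0) (b := min x u) (le_min hx.1 hu.1) le_rfl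
      ((min_le_left _ _).trans hx.2) ?_ ?_,
    measureReal_withDensity_eq_integral hg2 (fun z => mem_Icc_antidiag_density hβ)
      (MeasurableSet.preimage hS (by fun_prop)) (a := min x (1 - y)) (b := x) (min_le_left _ _)
      (le_min hx.1 (by linarith [hy.2])) hx.2 ?_ ?_,
    integral_curve_density hβ hx₀1 hx₀ (le_min hx.1 hu.1) ((min_le_left _ _).trans hx.2),
    integral_antidiag_density hβ hx₀1 hx₀ (min_le_left _ _) hx.2, e0]
  · ring
  · rintro t ⟨h1, h2⟩
    have h3 := (min_lt_iff.1 h1).resolve_left h2.not_gt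
    refine ⟨h2, ?_⟩
    simp only [mem_Iic]
    linarith
  · rintro t ⟨⟨h1, h2⟩, -⟩
    simp only [mem_Iic] at h1 h2
    exact ⟨(min_le_right _ _).trans (by linarith), h1⟩
  · rintro t ⟨-, h⟩
    rw [le_min_iff] at h
    exact ⟨h.1, huy ▸ hmono.monotoneOn (mem_Iic.2 (h.1.trans hx.2)) (mem_Iic.2 hu.2) h.2⟩
  · rintro t ⟨⟨h1, h2⟩, h3⟩
    refine ⟨h3.1, le_min h1 ?_⟩
    exact (hmono.le_iff_le (mem_Iic.2 h3.2) (mem_Iic.2 hu.2)).1 (huy ▸ h2)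

lemma sub_f231_le_of_le_one_sub (hβ : 0 < β) {x z : ℝ} (hx : x ∈ Icc (0 : ℝ) 1) (hxz : x ≤ z)
    (hz : z ≤ 1 - f231 β x) : x - f231 β x ≤ z - f231 β z := by
  have h1 := (f231_mem_Icc hβ hx).1
  have h := min_sub_f231_le hβ hxz hz (by linarith)
  rw [f231_one_sub_f231 hβ hx.2] at h
  rcases min_le_iff.1 h with h | h <;> linarith

lemma measureReal_mu231 (hβ : 0 < β) {x y : ℝ} (hx : x ∈ Icc (0 : ℝ) 1)
    (hy : y ∈ Icc (0 : ℝ) 1) :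
    (mu231 β).real (Iic x ×ˢ Iic y) =
      x - min (x - min y (f231 β x)) (max x (1 - f231 β (1 - y)) - y) := by
  obtain ⟨x₀, ⟨h0, h1⟩, hx₀⟩ := exists_exp_mul_eq hβ
  have hy' : 1 - y ∈ Icc (0 : ℝ) 1 := ⟨by linarith [hy.2], by linarith [hy.1]⟩
  have hfy := f231_mem_Icc hβ hy'
  set u := 1 - f231 β (1 - y) with hu
  have hu01 : u ∈ Icc (0 : ℝ) 1 := ⟨by linarith [hfy.2], by linarith [hfy.1]⟩
  have hfu : f231 β u = y := by
    rw [hu, f231_one_sub_f231 hβ hy'.2, sub_sub_cancel]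
  have hf0 := f231_eq_one_sub hβ hx₀
  have hmono := (f231_strictMonoOn hβ).monotoneOn
  have hmono' := fun {a b : ℝ} (hb : b ≤ 1) (hab : a ≤ b) => hmono (mem_Iic.2 (hab.trans hb)) hb hab
  rw [measureReal_mu231_eq_antidiagMass hβ h0.le h1.le hx₀ hx hy hu01 hfu]
  simp only [antidiagMass]
  rcases le_total u x with hux | hux
  · have hyx : y ≤ f231 β x := hfu ▸ hmono' hx.2 hux
    rw [min_eq_right hux, max_eq_left hux, min_eq_left hyx, min_self]
    rcases le_total u x₀ with h | h
    · have hy0 : y ≤ 1 - x₀ := hf0 ▸ hfu ▸ hmono' h1.le h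
      rw [min_eq_left h, min_assoc, min_eq_right (a := 1 - y) (by linarith), hfu]
      ring
    · have hy0 : 1 - x₀ ≤ y := hf0 ▸ hfu ▸ hmono' hu01.2 h
      rw [min_eq_right h, min_eq_right (h.trans hux), min_eq_right (a := x) (b := 1 - y)
        (by linarith), min_eq_left (by linarith)]
      linarith
  · have hyx : f231 β x ≤ y := hfu ▸ hmono' hu01.2 hux
    rw [min_eq_left hux, max_eq_right hux, min_eq_right hyx]
    suffices min (min x (1 - y)) x₀ - f231 β (min (min x (1 - y)) x₀) =
        min (x - f231 β x) (u - y) by linarith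
    rcases le_total u x₀ with h | h
    · have hy0 : y ≤ 1 - x₀ := hf0 ▸ hfu ▸ hmono' h1.le h
      have := sub_f231_le_of_le_one_sub hβ hx hux (by linarith)
      rw [min_eq_left (a := x) (b := 1 - y) (by linarith), min_eq_left (hux.trans h),
        min_eq_left (by linarith)]
    · have hy0 : 1 - x₀ ≤ y := hf0 ▸ hfu ▸ hmono' hu01.2 h
      rw [min_eq_left ((min_le_right _ _).trans (by linarith))]
      rcases le_total x (1 - y) with h2 | h2
      · have := sub_f231_le_of_le_one_sub hβ hx h2 (by linarith)
        rw [min_eq_left h2, min_eq_left (by linarith)]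
      · have := min_sub_f231_le hβ h2 hux hu01.2
        rw [hfu, min_eq_right (by linarith : u - y ≤ 1 - y - f231 β (1 - y))] at this
        rw [min_eq_right h2, min_eq_right this]
        linarith

lemma isPermuton_mu231 (hβ : 0 < β) : IsPermuton (mu231 β) := by
  refine isPermuton_of_measureReal (map_fst_mu231 hβ) fun y hy => ?_
  have hy' : 1 - y ∈ Icc (0 : ℝ) 1 := ⟨by linarith [hy.2], by linarith [hy.1]⟩
  have := (f231_mem_Icc hβ hy').1
  rw [measureReal_mu231 hβ (by simp) hy, f231_one hβ, min_eq_left hy.2, max_eq_left (by linarith)]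
  simp

end LimitPermuton

lemma isCloseToCurve_of_not_hasDeviation {β δ δ' : ℝ} (hβ : 0 < β) {n : ℕ} (hn : 1 ≤ n)
    {σ : Equiv.Perm (Fin n)} (hσ : ¬ HasDeviation β δ' σ)
    (hδ : (1 + Real.exp β) * (δ' + 1 / n) ≤ δ) : IsCloseToCurve β δ σ := by
  intro k hk
  have h : |(k : ℝ) - meanCount (odds β n) (k + tailMin σ k)| ≤ δ' * n := by
    by_contra! h
    exact hσ ⟨k, hk, h⟩
  exact (abs_tailMin_div_sub_f231_le hβ hn σ hk h).trans hδ

/-- Mallows random permutations with parameter `e^{β/n}` conditioned to avoid `231`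
converge weakly in probability to the permuton `μ^{231}_β` when `β > 0`
(which is indeed a permuton), and to the diagonal permuton when `β ≤ 0`. -/
theorem mallows231_converges_to_explicit_permuton (β : ℝ)
    (Ω : Type) [MeasureSpace Ω] [IsProbabilityMeasure (volume : Measure Ω)]
    (τ : (n : ℕ) → Ω → Equiv.Perm (Fin n))
    (hmeas : ∀ (n : ℕ) (σ : Equiv.Perm (Fin n)), MeasurableSet {ω | τ n ω = σ})
    (hlaw : ∀ (n : ℕ), 1 ≤ n → ∀ σ : Equiv.Perm (Fin n),
      volume {ω | τ n ω = σ} =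
        ENNReal.ofReal
          (if Avoids231 σ then Real.exp (β / n * invCount σ) / Z231 β n else 0)) :
    (0 < β →
      IsPermuton (mu231 β) ∧
      ∀ d : Measure (ℝ × ℝ) → Measure (ℝ × ℝ) → ℝ, MetrizesWeakConvUnitSq d →
        ∀ ε > (0:ℝ),
          Filter.Tendsto
            (fun n => volume {ω | ε < d (permutonOfPerm (τ n ω)) (mu231 β)})
            Filter.atTop (nhds 0)) ∧
    (β ≤ 0 →
      ∀ d : Measure (ℝ × ℝ) → Measure (ℝ × ℝ) → ℝ, MetrizesWeakConvUnitSq d →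
        ∀ ε > (0:ℝ),
          Filter.Tendsto
            (fun n => volume {ω | ε < d (permutonOfPerm (τ n ω)) diagPermuton})
            Filter.atTop (nhds 0)) := by
  refine ⟨fun hβ => ⟨isPermuton_mu231 hβ, fun d hd ε hε => ?_⟩, fun hβ d hd ε hε => ?_⟩
  · have := (isPermuton_mu231 hβ).1
    obtain ⟨δ, hδ, N, hN⟩ := hd.exists_forall_le (isPermuton_mu231 hβ).unitSquare
      (fun δ n σ => Avoids231 σ ∧ IsCloseToCurve β δ σ)
      (fun ν σ hν hσ x hx y hy => tendsto_permutonOfPerm_of_tendsto_exceedCount hν σ hx hy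
        fun k l hk hl hkx hly => by
          rw [measureReal_mu231 hβ hx hy, sub_sub_cancel]
          exact tendsto_exceedCount_of_isCloseToCurve hβ hν σ (fun m => (hσ m).1)
            (fun m => (hσ m).2) hx hy hk hl hkx hly) hε
    set δ' := δ / (2 * (1 + Real.exp β)) with hδ'
    have hδ'0 : 0 < δ' := by positivity
    refine tendsto_volume_of_law hlaw (fun n => HasDeviation β δ')
      (tendsto_sum_hasDeviation hβ.le hδ'0) _ ?_
    filter_upwards [eventually_ge_atTop N, eventually_ge_atTop 1,
      (tendsto_one_div_atTop_nhds_zero_nat (𝕜 := ℝ)).eventually_le_const hδ'0] with n hnN hn hn'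
    intro ω hω
    by_contra! h
    simp only [mem_ofPred_eq, not_or, not_not] at h
    refine absurd (hN n hnN (τ n ω) ⟨h.1, isCloseToCurve_of_not_hasDeviation hβ hn h.2 ?_⟩)
      (not_le.2 hω)
    calc (1 + Real.exp β) * (δ' + 1 / n) ≤ (1 + Real.exp β) * (δ' + δ') := by gcongr
      _ = δ := by rw [hδ']; field_simp; ring
  · have := isPermuton_diagPermuton.1
    obtain ⟨δ, hδ, N, hN⟩ := hd.exists_forall_le isPermuton_diagPermuton.unitSquare
      (fun δ n σ => (invCount σ : ℝ) ≤ δ * n ^ 2)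
      (fun ν σ hν hσ x hx y hy => tendsto_permutonOfPerm_of_tendsto_exceedCount hν σ hx hy
        fun k l hk hl hkx hly => by
          rw [measureReal_diagPermuton hx hy]
          exact tendsto_exceedCount_of_invCount hν σ hσ hk hl hkx hly) hε
    refine tendsto_volume_of_law hlaw (fun n σ => δ * n ^ 2 < invCount σ)
      (tendsto_sum_invCount_gt hβ hδ) _ ?_
    filter_upwards [eventually_ge_atTop N] with n hnN ω hω
    refine or_iff_not_imp_right.2 fun h => absurd (hN n hnN (τ n ω) (not_lt.1 h)) (not_le.2 hω)

end
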